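/- arXiv:2101.03440 — 2 statements merged into one kernel-verified Lean document; each statement's English description precedes it below -/
import Mathlib

section
/- There exist absolute constants C₁ and C₂ such that the following holds. Let a be a nonzero integer and set s = 2 if a is odd and s = 1 if a is even. Then uniformly for all positive integers k, all real x ≥ 2|a|, and all nonzero integers a, #{ primes p with −a < p ≤ x : ω((p+a)/s) = k } ≤ C₁ · (|a|/φ(|a|)) · π(x) · (log log x + C₂)^{k−1} / ((k−1)! · log x). -/
namespace ShiftedPrimes
open Finset Real

/-- Mertens' first theorem (upper bound). -/
theorem sum_log_div_prime_le {N : ℕ} (hN : 1 ≤ N) :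
    ∑ p ∈ Nat.primesLE N, log p / p ≤ log N + log 4 := by
  have hN0 : (0 : ℝ) < N := by exact_mod_cast hN
  have h1 : ∀ n ∈ Icc 1 N, ∑ p ∈ Nat.primesLE N, (if p ∣ n then log (p : ℝ) else 0) ≤ log N := by
    intro n hn
    rw [mem_Icc] at hn
    have hsub : (Nat.primesLE N).filter (· ∣ n) ⊆ n.primeFactors := by
      intro p hp
      simp only [mem_filter, Nat.mem_primesLE] at hp
      exact Nat.mem_primeFactors.2 ⟨hp.1.2, hp.2, by lia⟩
    rw [← sum_filter]
    calc ∑ p ∈ (Nat.primesLE N).filter (· ∣ n), log (p : ℝ)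
        ≤ ∑ p ∈ n.primeFactors, log (p : ℝ) :=
          sum_le_sum_of_subset_of_nonneg hsub fun p _ _ => log_natCast_nonneg p
      _ = log ((∏ p ∈ n.primeFactors, p : ℕ) : ℝ) := by
          rw [Nat.cast_prod, log_prod]
          intro p hp
          exact_mod_cast (Nat.prime_of_mem_primeFactors hp).ne_zero
      _ ≤ log N := by
          apply log_le_log
          · exact_mod_cast prod_pos fun p hp => (Nat.prime_of_mem_primeFactors hp).pos
          · exact_mod_cast (Nat.le_of_dvd (by lia) (Nat.prod_primeFactors_dvd n)).trans hn.2
  have h2 : ∑ p ∈ Nat.primesLE N, ((N : ℝ) / p - 1) * log p ≤ N * log N := by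
    calc ∑ p ∈ Nat.primesLE N, ((N : ℝ) / p - 1) * log p
        ≤ ∑ p ∈ Nat.primesLE N, ∑ n ∈ Icc 1 N, (if p ∣ n then log (p : ℝ) else 0) := by
          apply sum_le_sum
          intro p hp
          rw [← sum_filter, sum_const, nsmul_eq_mul]
          apply mul_le_mul_of_nonneg_right _ (log_natCast_nonneg p)
          have : ((Icc 1 N).filter (p ∣ ·)).card = N / p := by
            rw [← Nat.Ioc_filter_dvd_card_eq_div]
            rfl
          rw [this]
          exact (Nat.sub_one_lt_floor _).le.trans (by rw [Nat.floor_div_eq_div])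
      _ = ∑ n ∈ Icc 1 N, ∑ p ∈ Nat.primesLE N, (if p ∣ n then log (p : ℝ) else 0) := sum_comm
      _ ≤ ∑ n ∈ Icc 1 N, log N := sum_le_sum h1
      _ = N * log N := by simp
  have h3 : ∑ p ∈ Nat.primesLE N, log (p : ℝ) ≤ log 4 * N := by
    rw [← Chebyshev.theta_eq_sum_primesLE_log]
    exact Chebyshev.theta_le_log4_mul_x hN0.le
  have h4 : ∑ p ∈ Nat.primesLE N, ((N : ℝ) / p - 1) * log p
      = N * ∑ p ∈ Nat.primesLE N, log p / p - ∑ p ∈ Nat.primesLE N, log (p : ℝ) := by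
    rw [mul_sum, ← sum_sub_distrib]
    exact sum_congr rfl fun p _ => by ring
  rw [h4] at h2
  have : (N : ℝ) * ∑ p ∈ Nat.primesLE N, log p / p ≤ N * (log N + log 4) := by linarith
  exact le_of_mul_le_mul_left this hN0

theorem primesLE_succ_sum (f : ℕ → ℝ) (n : ℕ) :
    ∑ p ∈ Nat.primesLE (n + 1), f p
      = ∑ p ∈ Nat.primesLE n, f p + if (n + 1).Prime then f (n + 1) else 0 := by
  simp only [Nat.primesLE_eq_filter_range, sum_filter]
  rw [sum_range_succ]

/-- Mertens' second theorem (upper bound). -/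
theorem sum_inv_prime_le {N : ℕ} (hN : 2 ≤ N) :
    ∑ p ∈ Nat.primesLE N, (1 : ℝ) / p ≤ log (log N) + (3 - log (log 2)) := by
  have hl2 : 0 < log 2 := log_pos (by norm_num)
  have h4 : log 4 = 2 * log 2 := by
    rw [show (4 : ℝ) = 2 ^ 2 by norm_num, log_pow]; norm_num
  have key : ∑ p ∈ Nat.primesLE N, (1 : ℝ) / p - (∑ p ∈ Nat.primesLE N, log p / p) / log N
      ≤ log (log N) - log 4 / log N + (2 - log (log 2)) := by
    induction N, hN using Nat.le_induction with
    | base =>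
      have : Nat.primesLE 2 = {2} := by decide
      rw [this, h4]
      simp only [sum_singleton, Nat.cast_ofNat]
      field_simp
      linarith
    | succ n hn ih =>
      rw [primesLE_succ_sum (fun p => (1 : ℝ) / p), primesLE_succ_sum (fun p => log p / p)]
      have hA := sum_log_div_prime_le (N := n) (by lia)
      set A := ∑ p ∈ Nat.primesLE n, log p / p
      set B := ∑ p ∈ Nat.primesLE n, (1 : ℝ) / p
      have hn' : (2 : ℝ) ≤ n := by exact_mod_cast hn
      have ha : 0 < log n := log_pos (by linarith)
      have hb : log n ≤ log ((n + 1 : ℕ) : ℝ) := log_le_log (by linarith) (by push_cast; linarith)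
      set a := log (n : ℝ)
      have hcase : (B + if (n + 1).Prime then (1 : ℝ) / ((n + 1 : ℕ) : ℝ) else 0)
          - (A + if (n + 1).Prime then log ((n + 1 : ℕ) : ℝ) / ((n + 1 : ℕ) : ℝ) else 0)
            / log ((n + 1 : ℕ) : ℝ) = B - A / log ((n + 1 : ℕ) : ℝ) := by
        have : log ((n + 1 : ℕ) : ℝ) ≠ 0 := (ha.trans_le hb).ne'
        have h' : ((n + 1 : ℕ) : ℝ) ≠ 0 := by positivity
        split_ifs
        · field_simp
          ring
        · simp
      rw [hcase]
      set b := log ((n + 1 : ℕ) : ℝ)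
      have hb0 : 0 < b := ha.trans_le hb
      have e1 : log (log n) = log a := rfl
      have h5 : log (a / b) ≤ a / b - 1 := log_le_sub_one_of_pos (by positivity)
      rw [log_div ha.ne' hb0.ne'] at h5
      have h6 : A * (1 / a - 1 / b) ≤ (a + log 4) * (1 / a - 1 / b) := by
        apply mul_le_mul_of_nonneg_right hA
        have := one_div_le_one_div_of_le ha hb
        linarith
      have h7 : (a + log 4) * (1 / a - 1 / b) = 1 - a / b + log 4 / a - log 4 / b := by
        field_simp
        ring
      have h8 : A * (1 / a - 1 / b) = A / a - A / b := by ring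
      linarith
  have hA := sum_log_div_prime_le (N := N) (by lia)
  have hN' : (2 : ℝ) ≤ N := by exact_mod_cast hN
  have ha : 0 < log N := log_pos (by linarith)
  have : (∑ p ∈ Nat.primesLE N, log p / p) / log N ≤ 1 + log 4 / log N := by
    rw [div_le_iff₀ ha]
    field_simp
    linarith
  linarith

/-- The multiplicative weight `n ^ δ / φ n`. -/
noncomputable def rankinWeight (δ : ℝ) (n : ℕ) : ℝ := (n : ℝ) ^ δ / (Nat.totient n : ℝ)

theorem rankinWeight_nonneg (δ : ℝ) (n : ℕ) : 0 ≤ rankinWeight δ n := by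
  unfold rankinWeight; positivity

theorem rankinWeight_one (δ : ℝ) : rankinWeight δ 1 = 1 := by
  simp [rankinWeight]

theorem rankinWeight_mul (δ : ℝ) {m n : ℕ} (h : m.Coprime n) :
    rankinWeight δ (m * n) = rankinWeight δ m * rankinWeight δ n := by
  unfold rankinWeight
  rw [Nat.totient_mul h, Nat.cast_mul, Nat.cast_mul,
    mul_rpow (Nat.cast_nonneg m) (Nat.cast_nonneg n)]
  ring

theorem rankinWeight_prime_pow (δ : ℝ) {p v : ℕ} (hp : p.Prime) (hv : 1 ≤ v) :
    rankinWeight δ (p ^ v) = ((p : ℝ) ^ (δ - 1)) ^ v * (p / (p - 1)) := by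
  have hp1 : (1 : ℝ) < p := by exact_mod_cast hp.one_lt
  have hp0 : (0 : ℝ) < p := by linarith
  obtain ⟨w, rfl⟩ : ∃ w, v = w + 1 := ⟨v - 1, by lia⟩
  unfold rankinWeight
  rw [Nat.totient_prime_pow_succ hp, Nat.cast_mul, Nat.cast_sub hp.one_lt.le, Nat.cast_pow,
    Nat.cast_pow, rpow_sub_one hp0.ne', div_pow, Nat.cast_one, ← rpow_natCast_mul hp0.le, mul_comm,
    rpow_mul_natCast hp0.le]
  have : (p : ℝ) - 1 ≠ 0 := by linarith
  field_simp
  ring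

theorem sum_rankinWeight_prime_pow_le {δ : ℝ} (hδ : 0 ≤ δ) {N p : ℕ} (hp : p.Prime) (hpN : p ≤ N)
    (hδN : δ * log N ≤ log 2 / 4) (V : ℕ) :
    ∑ v ∈ Icc 1 V, rankinWeight δ (p ^ v)
      ≤ 1 / p + 2 * δ * (log p / p) + 7 * (p : ℝ) ^ (-(3 / 2) : ℝ) := by
  have hp2 : (2 : ℝ) ≤ p := by exact_mod_cast hp.two_le
  have hp0 : (0 : ℝ) < p := by linarith
  have hl2 : 0 < log 2 := log_pos (by norm_num)
  have hl2' : log 2 < 1 := by linarith [log_two_lt_d9]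
  have hlp : log 2 ≤ log p := log_le_log (by norm_num) hp2
  have hlN : log p ≤ log N := log_le_log hp0 (by exact_mod_cast hpN)
  have hδp : δ * log p ≤ log 2 / 4 := (mul_le_mul_of_nonneg_left hlN hδ).trans hδN
  have hδ4 : δ ≤ 1 / 4 := by
    by_contra! h
    nlinarith
  set r := (p : ℝ) ^ (δ - 1) with hr
  have hr0 : 0 < r := rpow_pos_of_pos hp0 _
  have hr34 : r ≤ (p : ℝ) ^ (-(3 / 4) : ℝ) :=
    rpow_le_rpow_of_exponent_le (by linarith) (by linarith)
  have hr6 : r ≤ 0.6 := by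
    have h1 : (p : ℝ) ^ (-(3 / 4) : ℝ) ≤ (2 : ℝ) ^ (-(3 / 4) : ℝ) :=
      rpow_le_rpow_of_nonpos (by norm_num) hp2 (by norm_num)
    have h2 : ((2 : ℝ) ^ (-(3 / 4) : ℝ)) ^ 4 = 1 / 8 := by
      rw [← rpow_mul_natCast (by norm_num)]
      norm_num
    have h3 : (2 : ℝ) ^ (-(3 / 4) : ℝ) ≤ 0.6 := by
      apply le_of_pow_le_pow_left₀ (n := 4) (by norm_num) (by norm_num)
      rw [h2]
      norm_num
    linarith
  have hsq : r ^ 2 ≤ (p : ℝ) ^ (-(3 / 2) : ℝ) := by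
    calc r ^ 2 ≤ ((p : ℝ) ^ (-(3 / 4) : ℝ)) ^ 2 := by gcongr
      _ = (p : ℝ) ^ (-(3 / 2) : ℝ) := by
        rw [← rpow_mul_natCast hp0.le]
        norm_num
  have hrp : r / p ≤ (p : ℝ) ^ (-(3 / 2) : ℝ) := by
    rw [hr, ← rpow_sub_one hp0.ne']
    exact rpow_le_rpow_of_exponent_le (by linarith) (by linarith)
  have hr1 : r ≤ 1 / p + 2 * δ * (log p / p) := by
    have h1 : r = exp (δ * log p) / p := by
      rw [hr, rpow_sub_one hp0.ne', rpow_def_of_pos hp0, mul_comm]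
    have ht0 : 0 ≤ δ * log p := by positivity
    have h2 : exp (δ * log p) ≤ 1 + 2 * (δ * log p) := by
      have := abs_exp_sub_one_le (x := δ * log p) (by rw [abs_of_nonneg ht0]; linarith)
      rw [abs_of_nonneg ht0] at this
      linarith [(abs_le.1 this).2]
    rw [h1]
    calc exp (δ * log p) / p ≤ (1 + 2 * (δ * log p)) / p := by gcongr
      _ = _ := by ring
  have hgeom : ∑ v ∈ Icc 1 V, r ^ v ≤ r + 2.5 * r ^ 2 := by
    have h1 : ∑ v ∈ Icc 1 V, r ^ v = r * ∑ v ∈ range V, r ^ v := by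
      rw [mul_sum, range_eq_Ico, ← Finset.sum_Ico_add_right_sub_eq (c := 1)]
      rw [show Icc 1 V = Ico 1 (V + 1) by ext; simp, zero_add]
      refine sum_congr rfl fun v hv => ?_
      rw [mem_Ico] at hv
      rw [← pow_succ', Nat.sub_add_cancel hv.1]
    have h2 : ∑ v ∈ range V, r ^ v ≤ 1 / (1 - r) := by
      rw [geom_sum_eq (by linarith), ← neg_div_neg_eq]
      apply div_le_div₀ (by norm_num) _ (by linarith) (by linarith)
      have : 0 ≤ r ^ V := by positivity
      linarith
    have h3 : 1 / (1 - r) ≤ 1 + 2.5 * r := by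
      rw [div_le_iff₀ (by linarith)]
      nlinarith
    rw [h1]
    nlinarith
  calc ∑ v ∈ Icc 1 V, rankinWeight δ (p ^ v)
      = (∑ v ∈ Icc 1 V, r ^ v) * (p / (p - 1)) := by
        rw [sum_mul]
        refine sum_congr rfl fun v hv => ?_
        rw [rankinWeight_prime_pow δ hp (mem_Icc.1 hv).1]
    _ ≤ (r + 2.5 * r ^ 2) * (1 + 2 / p) := by
        apply mul_le_mul hgeom _ (div_nonneg hp0.le (by linarith)) (by positivity)
        rw [div_le_iff₀ (by linarith)]
        field_simp
        nlinarith
    _ ≤ r + 5 * r ^ 2 + 2 * (r / p) := by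
        have h : 2 / (p : ℝ) ≤ 1 := by rw [div_le_one hp0]; exact hp2
        have : r ^ 2 * (2 / p) ≤ r ^ 2 * 1 := by gcongr
        have e : r * (2 / p) = 2 * (r / p) := by ring
        nlinarith
    _ ≤ _ := by linarith

theorem exists_sum_rankinWeight_prime_pow_le :
    ∃ K : ℝ, ∀ (δ : ℝ) (N V : ℕ), 0 ≤ δ → 2 ≤ N → δ * log N ≤ log 2 / 4 →
      ∑ p ∈ Nat.primesLE N, ∑ v ∈ Icc 1 V, rankinWeight δ (p ^ v) ≤ log (log N) + K := by
  have hsum : Summable fun n : ℕ => (n : ℝ) ^ (-(3 / 2) : ℝ) :=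
    summable_nat_rpow.2 (by norm_num)
  refine ⟨(3 - log (log 2)) + 2 + 7 * ∑' n : ℕ, (n : ℝ) ^ (-(3 / 2) : ℝ), ?_⟩
  intro δ N V hδ hN hδN
  have hl2 : 0 < log 2 := log_pos (by norm_num)
  have hl2' : log 2 < 1 := by linarith [log_two_lt_d9]
  have h1 := sum_inv_prime_le hN
  have h2 := sum_log_div_prime_le (N := N) (by lia)
  have h3 : ∑ p ∈ Nat.primesLE N, (p : ℝ) ^ (-(3 / 2) : ℝ) ≤ ∑' n : ℕ, (n : ℝ) ^ (-(3 / 2) : ℝ) :=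
    hsum.sum_le_tsum _ fun n _ => by positivity
  have hlN : log 2 ≤ log N := log_le_log (by norm_num) (by exact_mod_cast hN)
  have h4 : log 4 = 2 * log 2 := by
    rw [show (4 : ℝ) = 2 ^ 2 by norm_num, log_pow]; norm_num
  calc ∑ p ∈ Nat.primesLE N, ∑ v ∈ Icc 1 V, rankinWeight δ (p ^ v)
      ≤ ∑ p ∈ Nat.primesLE N,
          (1 / p + 2 * δ * (log p / p) + 7 * (p : ℝ) ^ (-(3 / 2) : ℝ)) := by
        refine sum_le_sum fun p hp => ?_
        rw [Nat.mem_primesLE] at hp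
        exact sum_rankinWeight_prime_pow_le hδ hp.2 hp.1 hδN V
    _ = ∑ p ∈ Nat.primesLE N, (1 : ℝ) / p + 2 * δ * ∑ p ∈ Nat.primesLE N, (log p / p)
          + 7 * ∑ p ∈ Nat.primesLE N, (p : ℝ) ^ (-(3 / 2) : ℝ) := by
        rw [sum_add_distrib, sum_add_distrib, mul_sum, mul_sum]
    _ ≤ _ := by
        have h5 : 2 * δ * ∑ p ∈ Nat.primesLE N, (log p / p) ≤ 2 * δ * (log N + log 4) := by gcongr
        have h6 : 2 * δ * (log N + log 4) ≤ 2 := by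
          rw [h4]
          have : δ * (2 * log 2) ≤ 2 * (δ * log N) := by nlinarith
          nlinarith
        linarith

theorem sum_le_sum_of_injOn {α β : Type*} [DecidableEq β] {s : Finset α} {t : Finset β}
    {f : α → ℝ} {g : β → ℝ} (i : α → β) (hi : ∀ x ∈ s, i x ∈ t) (hinj : Set.InjOn i s)
    (hfg : ∀ x ∈ s, f x ≤ g (i x)) (hg : ∀ y ∈ t, 0 ≤ g y) :
    ∑ x ∈ s, f x ≤ ∑ y ∈ t, g y :=
  calc ∑ x ∈ s, f x ≤ ∑ x ∈ s, g (i x) := sum_le_sum hfg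
    _ = ∑ y ∈ s.image i, g y := (sum_image hinj).symm
    _ ≤ ∑ y ∈ t, g y :=
      sum_le_sum_of_subset_of_nonneg (image_subset_iff.2 hi) fun y hy _ => hg y hy

theorem primeFactors_ordCompl (n p : ℕ) : (ordCompl[p] n).primeFactors = n.primeFactors.erase p := by
  rw [← Nat.support_factorization, Nat.factorization_ordCompl, Finsupp.support_erase,
    Nat.support_factorization]

theorem coprime_ordProj_ordCompl {n p : ℕ} (hp : p.Prime) (hn : n ≠ 0) :
    (ordProj[p] n).Coprime (ordCompl[p] n) :=
  (Nat.coprime_ordCompl hp hn).pow_left _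

/-- A multinomial bound: a nonnegative multiplicative function summed over the integers with `k`
distinct prime factors, all in `P`, is at most the `k`-th divided power of its sum over prime
powers. -/
theorem factorial_mul_sum_le_pow (f : ℕ → ℝ) (hf0 : ∀ n, 0 ≤ f n) (hf1 : f 1 = 1)
    (hfm : ∀ m n : ℕ, m.Coprime n → f (m * n) = f m * f n) (P : Finset ℕ) (Y k : ℕ) :
    (k.factorial : ℝ) *
        ∑ m ∈ Icc 1 Y with m.primeFactors ⊆ P ∧ m.primeFactors.card = k, f m
      ≤ (∑ p ∈ P, ∑ v ∈ Icc 1 Y, f (p ^ v)) ^ k := by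
  induction k with
  | zero =>
    simp only [Nat.factorial_zero, Nat.cast_one, one_mul, pow_zero]
    calc ∑ m ∈ Icc 1 Y with m.primeFactors ⊆ P ∧ m.primeFactors.card = 0, f m
        ≤ ∑ m ∈ {1}, f m := by
          apply sum_le_sum_of_subset_of_nonneg _ fun i _ _ => hf0 i
          intro m hm
          simp only [mem_filter, mem_Icc, card_eq_zero, Nat.primeFactors_eq_empty] at hm
          rw [mem_singleton]
          lia
      _ = 1 := by simp [hf1]
  | succ k ih =>
    set B : ℕ → Finset ℕ := fun k =>
      {m ∈ Icc 1 Y | m.primeFactors ⊆ P ∧ m.primeFactors.card = k} with hB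
    have h1 : ((k + 1 : ℕ) : ℝ) * ∑ m ∈ B (k + 1), f m
        = ∑ x ∈ (B (k + 1)).sigma fun m => m.primeFactors, f x.1 := by
      rw [sum_sigma, mul_sum]
      refine sum_congr rfl fun m hm => ?_
      change _ = ∑ _s ∈ m.primeFactors, f m
      rw [sum_const, (mem_filter.1 hm).2.2, nsmul_eq_mul]
    have h2 : ∑ x ∈ (B (k + 1)).sigma fun m => m.primeFactors, f x.1
        ≤ ∑ x ∈ (P ×ˢ Icc 1 Y) ×ˢ B k, f (x.1.1 ^ x.1.2) * f x.2 := by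
      have hmem : ∀ x ∈ (B (k + 1)).sigma fun m => m.primeFactors,
          x.1 ≠ 0 ∧ x.2.Prime ∧ x.2 ∣ x.1 ∧ x.1 ≤ Y ∧ x.1.primeFactors ⊆ P ∧
            x.1.primeFactors.card = k + 1 := by
        rintro ⟨m, p⟩ hx
        simp only [hB, mem_sigma, mem_filter, mem_Icc, Nat.mem_primeFactors] at hx
        exact ⟨hx.2.2.2, hx.2.1, hx.2.2.1, hx.1.1.2, hx.1.2.1, hx.1.2.2⟩
      refine sum_le_sum_of_injOn (fun x => ((x.2, x.1.factorization x.2), ordCompl[x.2] x.1))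
        ?_ ?_ ?_ fun _ _ => mul_nonneg (hf0 _) (hf0 _)
      · intro x hx
        obtain ⟨h0, hp, hd, hY, hP, hk⟩ := hmem x hx
        have hxp : x.2 ∈ x.1.primeFactors := Nat.mem_primeFactors.2 ⟨hp, hd, h0⟩
        simp only [hB, mem_product, mem_filter, mem_Icc, primeFactors_ordCompl]
        refine ⟨⟨hP hxp, (hp.dvd_iff_one_le_factorization h0).1 hd,
          (Nat.factorization_lt _ h0).le.trans hY⟩,
          ⟨Nat.ordCompl_pos _ h0, (Nat.ordCompl_le _ _).trans hY⟩,
          (erase_subset _ _).trans hP, ?_⟩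
        rw [card_erase_of_mem hxp, hk, Nat.add_sub_cancel]
      · rintro ⟨m, p⟩ _ ⟨m', p'⟩ _ h
        simp only [Prod.mk.injEq] at h
        obtain ⟨⟨rfl, h1⟩, h2⟩ := h
        have : m = m' := by
          rw [← Nat.ordProj_mul_ordCompl_eq_self m p, ← Nat.ordProj_mul_ordCompl_eq_self m' p, h2,
            h1]
        rw [this]
      · intro x hx
        obtain ⟨h0, hp, -⟩ := hmem x hx
        rw [← hfm _ _ (coprime_ordProj_ordCompl hp h0), Nat.ordProj_mul_ordCompl_eq_self]
    have h3 : ∑ x ∈ (P ×ˢ Icc 1 Y) ×ˢ B k, f (x.1.1 ^ x.1.2) * f x.2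
        = (∑ p ∈ P, ∑ v ∈ Icc 1 Y, f (p ^ v)) * ∑ m ∈ B k, f m := by
      rw [← sum_product', sum_mul_sum, ← sum_product']
    have h4 : 0 ≤ ∑ p ∈ P, ∑ v ∈ Icc 1 Y, f (p ^ v) :=
      sum_nonneg fun p _ => sum_nonneg fun v _ => hf0 _
    calc ((k + 1).factorial : ℝ) * ∑ m ∈ B (k + 1), f m
        = k.factorial * (((k + 1 : ℕ) : ℝ) * ∑ m ∈ B (k + 1), f m) := by
          rw [Nat.factorial_succ, Nat.cast_mul]
          ring
      _ ≤ k.factorial * ((∑ p ∈ P, ∑ v ∈ Icc 1 Y, f (p ^ v)) * ∑ m ∈ B k, f m) := by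
          rw [h1, ← h3]
          gcongr
      _ = (∑ p ∈ P, ∑ v ∈ Icc 1 Y, f (p ^ v)) * (k.factorial * ∑ m ∈ B k, f m) := by ring
      _ ≤ (∑ p ∈ P, ∑ v ∈ Icc 1 Y, f (p ^ v)) * (∑ p ∈ P, ∑ v ∈ Icc 1 Y, f (p ^ v)) ^ k := by
          gcongr
      _ = _ := by rw [pow_succ']

theorem four_pow_mul_exp_neg_le {c : ℝ} (hc : 0 < c) (i : ℕ) :
    (4 : ℝ) ^ (i + 1) * exp (-(c * (2 ^ i - 1))) ≤ 24 * exp c / c ^ 3 * (1 / 2) ^ i := by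
  have h := pow_div_factorial_le_exp (c * 2 ^ i) (by positivity) 3
  have h6 : ((Nat.factorial 3 : ℕ) : ℝ) = 6 := by norm_num [Nat.factorial]
  rw [h6, mul_pow] at h
  have e1 : exp (-(c * (2 ^ i - 1))) = exp c / exp (c * 2 ^ i) := by
    rw [← exp_sub]
    ring_nf
  have h8 : (4 : ℝ) ^ i * 2 ^ i = (2 ^ i) ^ 3 := by
    rw [show (4 : ℝ) = 2 ^ 2 by norm_num, ← pow_mul, ← pow_add, ← pow_mul]
    congr 1; ring
  rw [e1, div_pow, one_pow, pow_succ]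
  have ht : (0 : ℝ) < 2 ^ i := by positivity
  rw [← mul_div_assoc, div_mul_div_comm, mul_one, div_le_div_iff₀ (exp_pos _) (by positivity)]
  calc 4 ^ i * 4 * exp c * (c ^ 3 * 2 ^ i) = 24 * exp c * (c ^ 3 * (4 ^ i * 2 ^ i) / 6) := by ring
    _ ≤ 24 * exp c * exp (c * 2 ^ i) := by
        rw [h8]
        gcongr

/-- The sum of `rankinWeight` over smooth integers with exactly `j` prime factors. -/
theorem exists_sum_rankinWeight_le :
    ∃ C : ℝ, 0 ≤ log (log 2) + C ∧ ∀ (δ : ℝ) (N j : ℕ) (S : Finset ℕ), 0 ≤ δ → 2 ≤ N →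
      δ * log N ≤ log 2 / 4 →
      (∀ m ∈ S, m ≠ 0 ∧ m.primeFactors ⊆ Nat.primesLE N ∧ m.primeFactors.card = j) →
      ∑ m ∈ S, rankinWeight δ m ≤ (log (log N) + C) ^ j / j.factorial := by
  obtain ⟨K, hK⟩ := exists_sum_rankinWeight_prime_pow_le
  refine ⟨max K (-log (log 2)), by linarith [le_max_right K (-log (log 2))], ?_⟩
  intro δ N j S hδ hN hδN hS
  have hfac : (0 : ℝ) < j.factorial := by exact_mod_cast j.factorial_pos
  rw [le_div_iff₀' hfac]
  set Y := S.sup id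
  have h1 := factorial_mul_sum_le_pow (rankinWeight δ) (rankinWeight_nonneg δ) (rankinWeight_one δ)
    (fun m n h => rankinWeight_mul δ h) (Nat.primesLE N) Y j
  have h2 := hK δ N Y hδ hN hδN
  calc (j.factorial : ℝ) * ∑ m ∈ S, rankinWeight δ m
      ≤ j.factorial * ∑ m ∈ Icc 1 Y with m.primeFactors ⊆ Nat.primesLE N ∧
          m.primeFactors.card = j, rankinWeight δ m := by
        gcongr
        · exact fun _ _ _ => rankinWeight_nonneg δ _
        · intro m hm
          obtain ⟨h0, hp, hc⟩ := hS m hm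
          exact mem_filter.2 ⟨mem_Icc.2 ⟨Nat.pos_of_ne_zero h0, le_sup (f := id) hm⟩, hp, hc⟩
    _ ≤ _ := h1
    _ ≤ _ := by
        apply pow_le_pow_left₀
        · exact sum_nonneg fun p _ => sum_nonneg fun v _ => rankinWeight_nonneg δ _
        · linarith [le_max_left K (-log (log 2))]

/-- The sum over `m` with `j` prime factors of `1 / (φ m * log (y / m) ^ 2)`, restricted to those
`m` all of whose prime factors are at most `y / m`. -/
theorem exists_sum_inv_totient_log_sq_le :
    ∃ K C : ℝ, 0 ≤ K ∧ 0 ≤ log (log 2) + C ∧ ∀ (y : ℝ) (j : ℕ) (S : Finset ℕ), 2 ≤ y →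
      (∀ m ∈ S, m ≠ 0 ∧ 2 * (m : ℝ) ≤ y ∧ m.primeFactors.card = j ∧
        ∀ p ∈ m.primeFactors, (p : ℝ) * m ≤ y) →
      ∑ m ∈ S, 1 / ((Nat.totient m : ℝ) * log (y / m) ^ 2)
        ≤ K * ((log (log y) + C) ^ j / (j.factorial * log y ^ 2)) := by
  obtain ⟨C, hC0, hC⟩ := exists_sum_rankinWeight_le
  set c : ℝ := log 2 / 4 with hc
  have hl2 : 0 < log 2 := log_pos (by norm_num)
  have hc0 : 0 < c := by positivity
  refine ⟨2 * (24 * exp c / c ^ 3), C, by positivity, hC0, ?_⟩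
  intro y j S hy hS
  have hy0 : 0 < y := by linarith
  set L := log y with hL
  have hL2 : log 2 ≤ L := log_le_log (by norm_num) hy
  have hL0 : 0 < L := hl2.trans_le hL2
  have hX0 : 0 ≤ log L + C := by linarith [log_le_log hl2 hL2]
  have hfac : (0 : ℝ) < j.factorial := by exact_mod_cast j.factorial_pos
  have hlogs : ∀ m ∈ S, (0 : ℝ) < m ∧ log 2 ≤ log (y / m) ∧ log (y / m) ≤ L := by
    intro m hm
    obtain ⟨h0, h2, -⟩ := hS m hm
    have hm1 : (1 : ℝ) ≤ m := by exact_mod_cast Nat.pos_of_ne_zero h0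
    have hm0 : (0 : ℝ) < m := by linarith
    refine ⟨hm0, log_le_log (by norm_num) ?_, log_le_log (by positivity) (div_le_self hy0.le hm1)⟩
    rwa [le_div_iff₀ hm0]
  have hidx : ∀ m : ℕ, ∃ i : ℕ, m ∈ S →
      2 ^ i * log (y / m) ≤ L ∧ L < 2 ^ (i + 1) * log (y / m) := by
    intro m
    by_cases hm : m ∈ S
    · obtain ⟨-, h1, h2⟩ := hlogs m hm
      have h0 : 0 < log (y / m) := by linarith
      obtain ⟨i, hi⟩ := exists_nat_pow_near (x := L / log (y / m)) (y := 2)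
        (by rwa [le_div_iff₀ h0, one_mul]) (by norm_num)
      rw [le_div_iff₀ h0, div_lt_iff₀ h0] at hi
      exact ⟨i, fun _ => hi⟩
    · exact ⟨0, fun h => absurd h hm⟩
  choose idx hidx using hidx
  have hfib : ∀ i : ℕ, ∑ m ∈ S with idx m = i, 1 / ((Nat.totient m : ℝ) * log (y / m) ^ 2)
      ≤ (24 * exp c / c ^ 3 * (1 / 2) ^ i) * ((log L + C) ^ j / (j.factorial * L ^ 2)) := by
    intro i
    have hrhs : (0 : ℝ) ≤ (log L + C) ^ j / (j.factorial * L ^ 2) := by positivity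
    rcases (S.filter fun m => idx m = i).eq_empty_or_nonempty with he | ⟨m₀, hm₀⟩
    · rw [he, sum_empty]
      positivity
    rw [mem_filter] at hm₀
    have h2i : (0 : ℝ) < 2 ^ i := by positivity
    have hlog2 : log 2 ≤ L / 2 ^ i := by
      rw [le_div_iff₀ h2i]
      have h1 := (hidx m₀ hm₀.1).1
      rw [hm₀.2] at h1
      have h2 := (hlogs m₀ hm₀.1).2.1
      nlinarith
    set N := ⌊exp (L / 2 ^ i)⌋₊ with hN
    have hN2 : 2 ≤ N := by
      apply Nat.le_floor
      rw [Nat.cast_ofNat, ← log_le_iff_le_exp (by norm_num)]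
      exact hlog2
    have hN0 : (0 : ℝ) < N := by exact_mod_cast (by lia : 0 < N)
    have hlogN : log N ≤ L / 2 ^ i := by
      rw [log_le_iff_le_exp hN0]
      exact Nat.floor_le (exp_pos _).le
    have hlogN0 : 0 < log N := log_pos (by exact_mod_cast hN2)
    have h1i : (1 : ℝ) ≤ 2 ^ i := one_le_pow₀ (by norm_num)
    have hlogNL : log N ≤ L := hlogN.trans (div_le_self hL0.le h1i)
    set δ := c * 2 ^ i / L with hδ
    have hδ0 : 0 ≤ δ := by positivity
    have hδN : δ * log N ≤ log 2 / 4 := by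
      calc δ * log N ≤ δ * (L / 2 ^ i) := by gcongr
        _ = log 2 / 4 := by
          rw [hδ, ← hc]
          field_simp
    have hmem : ∀ m ∈ S.filter (fun m => idx m = i),
        m ≠ 0 ∧ m.primeFactors ⊆ Nat.primesLE N ∧ m.primeFactors.card = j := by
      intro m hm
      rw [mem_filter] at hm
      obtain ⟨h0, -, hcard, hp⟩ := hS m hm.1
      obtain ⟨hm0, hlo, hhi⟩ := hlogs m hm.1
      refine ⟨h0, fun p hpm => ?_, hcard⟩
      have hpp := Nat.prime_of_mem_primeFactors hpm
      refine Nat.mem_primesLE.2 ⟨Nat.le_floor ?_, hpp⟩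
      have hp0 : (0 : ℝ) < p := by exact_mod_cast hpp.pos
      rw [← log_le_iff_le_exp hp0, le_div_iff₀ h2i, mul_comm]
      refine le_trans ?_ (hm.2 ▸ (hidx m hm.1).1)
      gcongr
      rw [le_div_iff₀ hm0]
      exact hp p hpm
    have hterm : ∀ m ∈ S.filter (fun m => idx m = i),
        1 / ((Nat.totient m : ℝ) * log (y / m) ^ 2)
          ≤ (4 ^ (i + 1) * exp (-(c * (2 ^ i - 1))) / L ^ 2) * rankinWeight δ m := by
      intro m hm
      rw [mem_filter] at hm
      obtain ⟨hm0, hlo, hhi⟩ := hlogs m hm.1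
      obtain ⟨hi1, hi2⟩ := hidx m hm.1
      rw [hm.2] at hi1 hi2
      have hφ : (0 : ℝ) < Nat.totient m := by
        exact_mod_cast Nat.totient_pos.2 (by exact_mod_cast hm0)
      have hℓ : 0 < log (y / m) := by linarith
      have hpow : 1 ≤ exp (-(c * (2 ^ i - 1))) * (m : ℝ) ^ δ := by
        rw [rpow_def_of_pos hm0, ← exp_add, one_le_exp_iff]
        have hlm : log m = L - log (y / m) := by
          rw [log_div hy0.ne' hm0.ne']
          ring
        have h3 : log (y / m) ≤ L / 2 ^ i := by rwa [le_div_iff₀' h2i]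
        have h4 : (L - L / 2 ^ i) * δ ≤ log m * δ := by
          rw [hlm]
          gcongr
        have h5 : (L - L / 2 ^ i) * δ = c * (2 ^ i - 1) := by
          rw [hδ]
          field_simp
        linarith
      have hlsq : 1 / log (y / m) ^ 2 ≤ 4 ^ (i + 1) / L ^ 2 := by
        rw [div_le_div_iff₀ (by positivity) (by positivity), one_mul]
        calc L ^ 2 ≤ (2 ^ (i + 1) * log (y / m)) ^ 2 := by gcongr
          _ = 4 ^ (i + 1) * log (y / m) ^ 2 := by
            rw [mul_pow, ← pow_mul, mul_comm (i + 1), pow_mul]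
            norm_num
      unfold rankinWeight
      calc 1 / ((Nat.totient m : ℝ) * log (y / m) ^ 2)
          = 1 / (Nat.totient m : ℝ) * (1 / log (y / m) ^ 2) := by rw [one_div_mul_one_div]
        _ ≤ (exp (-(c * (2 ^ i - 1))) * (m : ℝ) ^ δ) / (Nat.totient m : ℝ)
              * (4 ^ (i + 1) / L ^ 2) := by gcongr
        _ = _ := by ring
    calc ∑ m ∈ S with idx m = i, 1 / ((Nat.totient m : ℝ) * log (y / m) ^ 2)
        ≤ ∑ m ∈ S with idx m = i,
            (4 ^ (i + 1) * exp (-(c * (2 ^ i - 1))) / L ^ 2) * rankinWeight δ m := sum_le_sum hterm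
      _ = (4 ^ (i + 1) * exp (-(c * (2 ^ i - 1))) / L ^ 2) *
            ∑ m ∈ S with idx m = i, rankinWeight δ m := by rw [mul_sum]
      _ ≤ (4 ^ (i + 1) * exp (-(c * (2 ^ i - 1))) / L ^ 2) *
            ((log (log N) + C) ^ j / j.factorial) := by
          gcongr
          exact hC δ N j _ hδ0 hN2 hδN hmem
      _ ≤ (24 * exp c / c ^ 3 * (1 / 2) ^ i / L ^ 2) * ((log L + C) ^ j / j.factorial) := by
          have h0 : 0 ≤ log (log N) + C := by
            have := log_le_log hl2 (log_le_log (by norm_num)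
              (by exact_mod_cast hN2 : (2 : ℝ) ≤ N))
            linarith
          refine mul_le_mul_of_nonneg_right ?_ (by positivity)
            |>.trans (mul_le_mul_of_nonneg_left ?_ (by positivity))
          · exact div_le_div_of_nonneg_right (four_pow_mul_exp_neg_le hc0 i) (by positivity)
          · gcongr
      _ = _ := by
          field_simp
  have hX : (0 : ℝ) ≤ (log L + C) ^ j / (j.factorial * L ^ 2) := by positivity
  calc ∑ m ∈ S, 1 / ((Nat.totient m : ℝ) * log (y / m) ^ 2)
      = ∑ i ∈ S.image idx, ∑ m ∈ S with idx m = i,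
          1 / ((Nat.totient m : ℝ) * log (y / m) ^ 2) :=
        (sum_fiberwise_of_maps_to (fun m hm => mem_image_of_mem idx hm) _).symm
    _ ≤ ∑ i ∈ S.image idx,
          (24 * exp c / c ^ 3 * (1 / 2) ^ i) * ((log L + C) ^ j / (j.factorial * L ^ 2)) :=
        sum_le_sum fun i _ => hfib i
    _ = (24 * exp c / c ^ 3) * (∑ i ∈ S.image idx, (1 / 2 : ℝ) ^ i)
          * ((log L + C) ^ j / (j.factorial * L ^ 2)) := by
        rw [← sum_mul, mul_sum]
    _ ≤ (24 * exp c / c ^ 3) * 2 * ((log L + C) ^ j / (j.factorial * L ^ 2)) := by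
        gcongr
        exact (summable_geometric_two.sum_le_tsum _ fun _ _ => by positivity).trans_eq
          tsum_geometric_two
    _ = _ := by ring

open BoundingSieve
open scoped ArithmeticFunction.Moebius

theorem sum_moebius_between {l m P : ℕ} (hP : Squarefree P) (hm : m ∣ P) (hl : l ∣ m) :
    ∑ d ∈ P.divisors with l ∣ d ∧ d ∣ m, μ d = if l = m then μ l else 0 := by
  have hmsq : Squarefree m := hP.squarefree_of_dvd hm
  obtain ⟨e, rfl⟩ := hl
  have hl0 : l ≠ 0 := by rintro rfl; simp at hmsq
  have he0 : e ≠ 0 := by rintro rfl; simp at hmsq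
  have hco : l.Coprime e := (Nat.squarefree_mul_iff.1 hmsq).1
  have : ({d ∈ P.divisors | l ∣ d ∧ d ∣ l * e} : Finset ℕ) = e.divisors.image (l * ·) := by
    ext d
    simp only [mem_filter, Nat.mem_divisors, mem_image]
    constructor
    · rintro ⟨-, ⟨c, rfl⟩, hd⟩
      exact ⟨c, ⟨Nat.dvd_of_mul_dvd_mul_left (Nat.pos_of_ne_zero hl0) hd, he0⟩, rfl⟩
    · rintro ⟨c, ⟨hc, -⟩, rfl⟩
      have : l * c ∣ l * e := mul_dvd_mul_left l hc
      exact ⟨⟨this.trans hm, hP.ne_zero⟩, dvd_mul_right _ _, this⟩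
  rw [this, sum_image (fun x _ y _ h => Nat.eq_of_mul_eq_mul_left (Nat.pos_of_ne_zero hl0) h)]
  have h2 : ∀ c ∈ e.divisors, μ (l * c) = μ l * μ c := fun c hc =>
    ArithmeticFunction.isMultiplicative_moebius.map_mul_of_coprime
      (hco.coprime_dvd_right (Nat.dvd_of_mem_divisors hc))
  rw [sum_congr rfl h2, ← mul_sum]
  have h3 : ∑ c ∈ e.divisors, μ c = if e = 1 then 1 else 0 := by
    rw [← ArithmeticFunction.coe_mul_zeta_apply, ArithmeticFunction.moebius_mul_coe_zeta,
      ArithmeticFunction.one_apply]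
  rw [h3]
  by_cases he : e = 1
  · simp [he]
  · rw [if_neg he, if_neg, mul_zero]
    intro h
    exact he (Nat.eq_of_mul_eq_mul_left (Nat.pos_of_ne_zero hl0) (by rw [mul_one]; exact h.symm))

/-- The sum `∑ g(l)` over `l ∣ P` with `l ≤ R`, the reciprocal of the optimal main term. -/
noncomputable def selbergSum (s : BoundingSieve) (R : ℕ) : ℝ :=
  ∑ l ∈ s.prodPrimes.divisors with l ≤ R, s.selbergTerms l

/-- Selberg's choice of weights for the `Λ²` sieve of level `R`. -/
noncomputable def selbergWeight (s : BoundingSieve) (R d : ℕ) : ℝ :=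
  if d ∣ s.prodPrimes then
    μ d * (s.nu d)⁻¹ * (selbergSum s R)⁻¹ *
      ∑ l ∈ s.prodPrimes.divisors with d ∣ l ∧ l ≤ R, s.selbergTerms l
  else 0

variable (s : BoundingSieve) {R : ℕ}

theorem selbergSum_pos (hR : 1 ≤ R) : 0 < selbergSum s R := by
  unfold selbergSum
  refine sum_pos (fun l hl => selbergTerms_pos ?_) ⟨1, ?_⟩
  · exact Nat.dvd_of_mem_divisors (mem_filter.1 hl).1
  · simp [hR, prodPrimes_ne_zero]

theorem selbergWeight_one (hR : 1 ≤ R) : selbergWeight s R 1 = 1 := by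
  have := (selbergSum_pos s hR).ne'
  unfold selbergWeight
  simp only [one_dvd, true_and, if_true, s.nu_mult.map_one]
  rw [← selbergSum]
  simp [this]

theorem selbergWeight_eq_zero {d : ℕ} (hd : R < d) : selbergWeight s R d = 0 := by
  unfold selbergWeight
  split_ifs
  · rw [filter_false_of_mem, sum_empty, mul_zero]
    rintro l hl ⟨h1, h2⟩
    exact absurd (Nat.le_of_dvd (Nat.pos_of_mem_divisors hl) h1) (by omega)
  · rfl

theorem abs_selbergWeight_le (hR : 1 ≤ R) {d : ℕ} (hd : d ∣ s.prodPrimes) :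
    |selbergWeight s R d| ≤ (s.nu d)⁻¹ := by
  have hS := selbergSum_pos s hR
  have hnu := nu_pos_of_dvd_prodPrimes hd
  rw [selbergWeight, if_pos hd, abs_mul, abs_mul, abs_mul, abs_of_pos (inv_pos.2 hnu),
    abs_of_pos (inv_pos.2 hS)]
  have h1 : |((μ d : ℤ) : ℝ)| ≤ 1 := by
    exact_mod_cast ArithmeticFunction.abs_moebius_le_one
  have h2 : |∑ l ∈ s.prodPrimes.divisors with d ∣ l ∧ l ≤ R, s.selbergTerms l| ≤
      selbergSum s R := by
    rw [abs_of_nonneg]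
    · apply sum_le_sum_of_subset_of_nonneg
      · intro l hl
        simp only [mem_filter] at hl ⊢
        exact ⟨hl.1, hl.2.2⟩
      · intro l hl _
        exact (selbergTerms_pos (Nat.dvd_of_mem_divisors (mem_filter.1 hl).1)).le
    · exact sum_nonneg fun l hl =>
        (selbergTerms_pos (Nat.dvd_of_mem_divisors (mem_filter.1 hl).1)).le
  calc _ ≤ 1 * (s.nu d)⁻¹ * (selbergSum s R)⁻¹ * selbergSum s R := by
        gcongr
    _ = (s.nu d)⁻¹ := by field_simp

theorem sum_nu_mul_selbergWeight {l : ℕ} (hl : l ∣ s.prodPrimes) :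
    ∑ d ∈ s.prodPrimes.divisors, (if l ∣ d then s.nu d * selbergWeight s R d else 0) =
      if l ≤ R then μ l * s.selbergTerms l * (selbergSum s R)⁻¹ else 0 := by
  have h1 : ∀ d ∈ s.prodPrimes.divisors,
      (if l ∣ d then s.nu d * selbergWeight s R d else 0) =
      ∑ m ∈ s.prodPrimes.divisors with m ≤ R,
        (selbergSum s R)⁻¹ * s.selbergTerms m * (if l ∣ d ∧ d ∣ m then (μ d : ℝ) else 0) := by
    intro d hd
    have hd' := Nat.dvd_of_mem_divisors hd
    have hnu := nu_pos_of_dvd_prodPrimes hd'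
    by_cases h : l ∣ d
    · simp only [h, true_and, if_true, selbergWeight, hd']
      have : ({m ∈ s.prodPrimes.divisors | d ∣ m ∧ m ≤ R} : Finset ℕ) =
          {m ∈ ({m ∈ s.prodPrimes.divisors | m ≤ R} : Finset ℕ) | d ∣ m} := by
        rw [filter_filter]; congr 1; ext; simp [and_comm]
      rw [this, sum_filter, mul_sum, mul_sum]
      refine sum_congr rfl fun m _ => ?_
      split_ifs
      · field_simp
      · simp
    · simp [h]
  rw [sum_congr rfl h1, sum_comm]
  simp_rw [← mul_sum]
  have h2 : ∀ m ∈ ({m ∈ s.prodPrimes.divisors | m ≤ R} : Finset ℕ),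
      (selbergSum s R)⁻¹ * s.selbergTerms m *
        ∑ d ∈ s.prodPrimes.divisors, (if l ∣ d ∧ d ∣ m then (μ d : ℝ) else 0) =
      if m = l then (μ l : ℝ) * s.selbergTerms l * (selbergSum s R)⁻¹ else 0 := by
    intro m hm
    have hm' := Nat.dvd_of_mem_divisors (mem_filter.1 hm).1
    rw [← sum_filter]
    by_cases hlm : l ∣ m
    · have := sum_moebius_between s.prodPrimes_squarefree hm' hlm
      rw [← Int.cast_sum, this]
      by_cases hh : l = m
      · subst hh; simp; ring
      · simp [hh, Ne.symm hh]
    · rw [filter_false_of_mem, sum_empty, mul_zero, if_neg]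
      · rintro rfl; exact hlm dvd_rfl
      · rintro d _ ⟨h3, h4⟩; exact hlm (h3.trans h4)
  rw [sum_congr rfl h2, sum_ite_eq']
  simp [hl, prodPrimes_ne_zero]

theorem mainSum_selbergWeight (hR : 1 ≤ R) :
    s.mainSum (lambdaSquared (selbergWeight s R)) = (selbergSum s R)⁻¹ := by
  have hS := selbergSum_pos s hR
  rw [mainSum_lambdaSquared_eq_sum_mul_sum_sq]
  have h1 : ∀ l ∈ s.prodPrimes.divisors, (s.selbergTerms l)⁻¹ *
      (∑ d ∈ s.prodPrimes.divisors, if l ∣ d then s.nu d * selbergWeight s R d else 0) ^ 2 =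
      if l ≤ R then s.selbergTerms l * ((selbergSum s R)⁻¹ ^ 2) else 0 := by
    intro l hl
    have hl' := Nat.dvd_of_mem_divisors hl
    have hg := selbergTerms_pos hl'
    rw [sum_nu_mul_selbergWeight s hl']
    split_ifs
    · have h2 : ((μ l : ℤ) : ℝ) ^ 2 = 1 := by
        exact_mod_cast ArithmeticFunction.moebius_sq_eq_one_of_squarefree
          (squarefree_of_dvd_prodPrimes hl')
      rw [mul_pow, mul_pow, h2]
      field_simp
    · simp
  rw [sum_congr rfl h1, ← sum_filter, ← sum_mul, ← selbergSum]
  field_simp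

theorem lambdaSquared_selbergWeight_eq_zero {d : ℕ} (hd : R ^ 2 < d) :
    lambdaSquared (selbergWeight s R) d = 0 := by
  unfold lambdaSquared
  refine sum_eq_zero fun d₁ h₁ => sum_eq_zero fun d₂ h₂ => ?_
  split_ifs with h
  · by_cases h3 : R < d₁
    · simp [selbergWeight_eq_zero s h3]
    by_cases h4 : R < d₂
    · simp [selbergWeight_eq_zero s h4]
    exfalso
    have h5 : d₁.lcm d₂ ≤ d₁ * d₂ := Nat.le_of_dvd
      (Nat.mul_pos (Nat.pos_of_mem_divisors h₁) (Nat.pos_of_mem_divisors h₂))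
      (Nat.lcm_dvd_mul _ _)
    have : d₁ * d₂ ≤ R * R := Nat.mul_le_mul (by omega) (by omega)
    nlinarith
  · rfl

theorem abs_selbergWeight_le_level (hR : 1 ≤ R) (hnu : ∀ d, d ∣ s.prodPrimes → (s.nu d)⁻¹ ≤ d)
    (d : ℕ) : |selbergWeight s R d| ≤ if d ≤ R then (R : ℝ) else 0 := by
  split_ifs with h
  · by_cases hd : d ∣ s.prodPrimes
    · exact (abs_selbergWeight_le s hR hd).trans ((hnu d hd).trans (by exact_mod_cast h))
    · simp [selbergWeight, hd]
  · rw [selbergWeight_eq_zero s (by omega), abs_zero]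

theorem abs_lambdaSquared_selbergWeight_le (hR : 1 ≤ R)
    (hnu : ∀ d, d ∣ s.prodPrimes → (s.nu d)⁻¹ ≤ d) (d : ℕ) :
    |lambdaSquared (selbergWeight s R) d| ≤ (R : ℝ) ^ 4 := by
  have hw := abs_selbergWeight_le_level s hR hnu
  have hcard : ∀ d : ℕ, ∑ d₁ ∈ d.divisors, |selbergWeight s R d₁| ≤ (R : ℝ) ^ 2 := by
    intro d
    calc ∑ d₁ ∈ d.divisors, |selbergWeight s R d₁|
        ≤ ∑ d₁ ∈ d.divisors, if d₁ ≤ R then (R : ℝ) else 0 := sum_le_sum fun _ _ => hw _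
      _ = (#{d₁ ∈ d.divisors | d₁ ≤ R} : ℝ) * R := by
          rw [← sum_filter, sum_const, nsmul_eq_mul]
      _ ≤ (R : ℝ) * R := by
          gcongr
          calc #{d₁ ∈ d.divisors | d₁ ≤ R} ≤ #(Icc 1 R) := by
                apply card_le_card
                intro e he
                simp only [mem_filter, mem_Icc] at he ⊢
                exact ⟨Nat.pos_of_mem_divisors he.1, he.2⟩
            _ = R := by simp
      _ = (R : ℝ) ^ 2 := by ring
  unfold lambdaSquared
  calc |∑ d₁ ∈ d.divisors, ∑ d₂ ∈ d.divisors,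
        if d = d₁.lcm d₂ then selbergWeight s R d₁ * selbergWeight s R d₂ else 0|
      ≤ ∑ d₁ ∈ d.divisors, ∑ d₂ ∈ d.divisors,
        |selbergWeight s R d₁| * |selbergWeight s R d₂| := by
        refine (abs_sum_le_sum_abs _ _).trans (sum_le_sum fun d₁ _ => ?_)
        refine (abs_sum_le_sum_abs _ _).trans (sum_le_sum fun d₂ _ => ?_)
        split_ifs
        · rw [abs_mul]
        · rw [abs_zero]; positivity
    _ = (∑ d₁ ∈ d.divisors, |selbergWeight s R d₁|) *
        ∑ d₂ ∈ d.divisors, |selbergWeight s R d₂| := by rw [sum_mul_sum]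
    _ ≤ (R : ℝ) ^ 2 * (R : ℝ) ^ 2 := by
        exact mul_le_mul (hcard d) (hcard d) (sum_nonneg fun _ _ => abs_nonneg _) (by positivity)
    _ = (R : ℝ) ^ 4 := by ring

/-- Selberg's upper bound sieve with a crude remainder term. -/
theorem siftedSum_le_selberg (hR : 1 ≤ R) (hnu : ∀ d, d ∣ s.prodPrimes → (s.nu d)⁻¹ ≤ d)
    (hrem : ∀ d, d ∣ s.prodPrimes → |s.rem d| ≤ d) :
    s.siftedSum ≤ s.totalMass / selbergSum s R + (R : ℝ) ^ 8 := by
  refine (siftedSum_le_mainSum_errSum_of_upperMoebius _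
    (upperMoebius_lambdaSquared _ (selbergWeight_one s hR))).trans ?_
  rw [mainSum_selbergWeight s hR, div_eq_mul_inv]
  gcongr
  unfold errSum
  calc ∑ d ∈ s.prodPrimes.divisors, |lambdaSquared (selbergWeight s R) d| * |s.rem d|
      ≤ ∑ d ∈ s.prodPrimes.divisors, if d ≤ R ^ 2 then (R : ℝ) ^ 6 else 0 := by
        refine sum_le_sum fun d hd => ?_
        split_ifs with h
        · calc _ ≤ (R : ℝ) ^ 4 * (R : ℝ) ^ 2 := by
                gcongr
                · exact abs_lambdaSquared_selbergWeight_le s hR hnu d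
                · exact (hrem d (Nat.dvd_of_mem_divisors hd)).trans (by exact_mod_cast h)
            _ = _ := by ring
        · rw [lambdaSquared_selbergWeight_eq_zero s (by omega), abs_zero, zero_mul]
    _ = (#{d ∈ s.prodPrimes.divisors | d ≤ R ^ 2} : ℝ) * (R : ℝ) ^ 6 := by
        rw [← sum_filter, sum_const, nsmul_eq_mul]
    _ ≤ (R : ℝ) ^ 2 * (R : ℝ) ^ 6 := by
        gcongr
        have : #{d ∈ s.prodPrimes.divisors | d ≤ R ^ 2} ≤ #(Icc 1 (R ^ 2)) := by
          apply card_le_card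
          intro e he
          simp only [mem_filter, mem_Icc] at he ⊢
          exact ⟨Nat.pos_of_mem_divisors he.1, he.2⟩
        rw [Nat.card_Icc, Nat.add_sub_cancel] at this
        exact_mod_cast this
    _ = (R : ℝ) ^ 8 := by ring

/-- The completely multiplicative function with `p ↦ 1 / p` for `p ∣ M` and `p ↦ 2 / p`
otherwise: the sieve density for two linear forms whose discriminant has the primes of `M`. -/
noncomputable def density (M : ℕ) : ℕ →* ℝ where
  toFun n := if n = 0 then 0 else
    n.factorization.prod fun p k => ((if p ∣ M then 1 else 2 : ℝ) / p) ^ k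
  map_one' := by simp
  map_mul' m n := by
    by_cases hm : m = 0
    · simp [hm]
    by_cases hn : n = 0
    · simp [hn]
    rw [if_neg hm, if_neg hn, if_neg (mul_ne_zero hm hn), Nat.factorization_mul hm hn,
      Finsupp.prod_add_index']
    · simp
    · intro p i j; rw [pow_add]

theorem density_zero (M : ℕ) : density M 0 = 0 := by simp [density]

theorem density_prime (M : ℕ) {p : ℕ} (hp : p.Prime) :
    density M p = (if p ∣ M then 1 else 2 : ℝ) / p := by
  simp [density, hp.ne_zero, hp.factorization]

theorem density_nonneg (M n : ℕ) : 0 ≤ density M n := by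
  unfold density
  simp only [MonoidHom.coe_mk, OneHom.coe_mk]
  split_ifs
  · rfl
  · exact prod_nonneg fun p _ => by positivity

theorem density_prime_pos (M : ℕ) {p : ℕ} (hp : p.Prime) : 0 < density M p := by
  rw [density_prime M hp]
  have := hp.pos
  split_ifs <;> positivity

theorem density_prime_lt_one {M p : ℕ} (hM : 2 ∣ M) (hp : p.Prime) : density M p < 1 := by
  rw [density_prime M hp, div_lt_one (by exact_mod_cast hp.pos)]
  split_ifs with h
  · exact_mod_cast hp.one_lt
  · have : p ≠ 2 := by rintro rfl; exact h hM
    have := hp.two_le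
    have : 2 < p := by omega
    exact_mod_cast this

theorem sum_le_prod_geometric {f : ℕ →* ℝ} (hf0 : ∀ n, 0 ≤ f n)
    (hf1 : ∀ p : ℕ, p.Prime → f p < 1) {T S : Finset ℕ} (hT : ∀ p ∈ T, p.Prime)
    (hS : ∀ m ∈ S, m ∈ Nat.factoredNumbers T) :
    ∑ m ∈ S, f m ≤ ∏ p ∈ T, (1 - f p)⁻¹ := by
  have h := (EulerProduct.summable_and_hasSum_factoredNumbers_prod_filter_prime_geometric
    (f := f) (fun {p} hp => by rw [norm_of_nonneg (hf0 p)]; exact hf1 p hp) T).2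
  rw [filter_true_of_mem hT] at h
  have h2 := sum_le_hasSum (S.subtype (· ∈ Nat.factoredNumbers T)) (fun i _ => hf0 i) h
  rwa [sum_subtype_eq_sum_filter, filter_true_of_mem hS] at h2

theorem sum_le_sum_mul_prod_geometric {f : ℕ →* ℝ} (hf0 : ∀ n, 0 ≤ f n)
    (hf1 : ∀ p : ℕ, p.Prime → f p < 1) (R : ℕ) :
    ∑ n ∈ Icc 1 R, f n ≤
      ∑ l ∈ (primorial R).divisors with l ≤ R, f l * ∏ p ∈ l.primeFactors, (1 - f p)⁻¹ := by
  have hmaps : ∀ n ∈ Icc 1 R, (∏ p ∈ n.primeFactors, p) ∈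
      ({l ∈ (primorial R).divisors | l ≤ R} : Finset ℕ) := by
    intro n hn
    rw [mem_Icc] at hn
    simp only [mem_filter, Nat.mem_divisors]
    refine ⟨⟨?_, primorial_ne_zero R⟩,
      (Nat.le_of_dvd hn.1 (Nat.prod_primeFactors_dvd n)).trans hn.2⟩
    rw [primorial_eq_prod_primesLE]
    apply prod_dvd_prod_of_subset
    intro p hp
    rw [Nat.mem_primesLE]
    exact ⟨(Nat.le_of_mem_primeFactors hp).trans hn.2, Nat.prime_of_mem_primeFactors hp⟩
  rw [← sum_fiberwise_of_maps_to hmaps]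
  refine sum_le_sum fun l hl => ?_
  have hl0 : l ≠ 0 := (Nat.pos_of_mem_divisors (mem_filter.1 hl).1).ne'
  have key : ∀ n ∈ ({n ∈ Icc 1 R | ∏ p ∈ n.primeFactors, p = l} : Finset ℕ),
      l * (n / l) = n ∧ n ≠ 0 ∧ l.primeFactors = n.primeFactors := by
    intro n hn
    simp only [mem_filter, mem_Icc] at hn
    refine ⟨Nat.mul_div_cancel' (hn.2 ▸ Nat.prod_primeFactors_dvd n), by omega, ?_⟩
    rw [← hn.2, Nat.primeFactors_prod fun p hp => Nat.prime_of_mem_primeFactors hp]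
  have h1 : ∑ n ∈ Icc 1 R with ∏ p ∈ n.primeFactors, p = l, f n =
      f l * ∑ k ∈ ({n ∈ Icc 1 R | ∏ p ∈ n.primeFactors, p = l} : Finset ℕ).image (· / l), f k := by
    rw [sum_image, mul_sum]
    · refine sum_congr rfl fun n hn => ?_
      rw [← map_mul, (key n hn).1]
    · intro x hx y hy hxy
      rw [← (key x hx).1, ← (key y hy).1]
      exact congrArg (l * ·) hxy
  rw [h1]
  refine mul_le_mul_of_nonneg_left (sum_le_prod_geometric hf0 hf1
    (fun p hp => Nat.prime_of_mem_primeFactors hp) ?_) (hf0 l)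
  intro k hk
  obtain ⟨n, hn, rfl⟩ := mem_image.1 hk
  obtain ⟨h2, h3, h4⟩ := key n hn
  rw [Nat.mem_factoredNumbers']
  intro p hp hpk
  rw [h4, Nat.mem_primeFactors]
  exact ⟨hp, hpk.trans (Dvd.intro_left _ h2), h3⟩

/-- Reciprocals of integers, as a monoid homomorphism. -/
noncomputable def recip : ℕ →* ℝ where
  toFun n := (n : ℝ)⁻¹
  map_one' := by simp
  map_mul' m n := by push_cast; rw [mul_inv]

theorem sum_inv_factoredNumbers_le {M : ℕ} (hM : M ≠ 0) (R : ℕ) :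
    ∑ b ∈ Icc 1 R, (if b.primeFactors ⊆ M.primeFactors then (b : ℝ)⁻¹ else 0) ≤
      (M : ℝ) / Nat.totient M := by
  have h1 := sum_le_prod_geometric (f := recip) (fun n => by simp [recip])
    (fun p hp => by simpa [recip] using inv_lt_one_of_one_lt₀ (by exact_mod_cast hp.one_lt))
    (T := M.primeFactors) (S := {b ∈ Icc 1 R | b.primeFactors ⊆ M.primeFactors})
    (fun p hp => Nat.prime_of_mem_primeFactors hp) (by
      intro m hm
      simp only [mem_filter, mem_Icc] at hm
      rw [Nat.mem_factoredNumbers']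
      intro p hp hpm
      exact hm.2 (Nat.mem_primeFactors.2 ⟨hp, hpm, by omega⟩))
  rw [← sum_filter]
  refine h1.trans (le_of_eq ?_)
  have h2 : (Nat.totient M : ℝ) = M * ∏ p ∈ M.primeFactors, (1 - (p : ℝ)⁻¹) := by
    have := Nat.totient_eq_mul_prod_factors M
    have h := congrArg (Rat.cast : ℚ → ℝ) this
    push_cast at h
    exact h
  rw [h2, prod_inv_distrib]
  have hM' : (M : ℝ) ≠ 0 := by exact_mod_cast hM
  simp only [recip, MonoidHom.coe_mk, OneHom.coe_mk]
  rw [← div_div, div_self hM', one_div]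

theorem sum_Icc_sum_divisorsAntidiagonal (R : ℕ) (g : ℕ × ℕ → ℝ) :
    ∑ t ∈ Icc 1 R, ∑ x ∈ t.divisorsAntidiagonal, g x =
      ∑ x ∈ Icc 1 R ×ˢ Icc 1 R with x.1 * x.2 ≤ R, g x := by
  have hm : ∀ x ∈ ({x ∈ Icc 1 R ×ˢ Icc 1 R | x.1 * x.2 ≤ R} : Finset (ℕ × ℕ)),
      x.1 * x.2 ∈ Icc 1 R := by
    intro x hx
    simp only [mem_filter, mem_product, mem_Icc] at hx ⊢
    exact ⟨Nat.mul_pos hx.1.1.1 hx.1.2.1, hx.2⟩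
  rw [← sum_fiberwise_of_maps_to hm]
  refine sum_congr rfl fun t ht => sum_congr ?_ fun _ _ => rfl
  ext x
  simp only [mem_filter, mem_product, mem_Icc, Nat.mem_divisorsAntidiagonal] at ht ⊢
  constructor
  · rintro ⟨rfl, h⟩
    have h1 : x.1 ≠ 0 := left_ne_zero_of_mul h
    have h2 : x.2 ≠ 0 := right_ne_zero_of_mul h
    refine ⟨⟨⟨⟨by omega, ?_⟩, ⟨by omega, ?_⟩⟩, ht.2⟩, rfl⟩
    · exact (Nat.le_mul_of_pos_right _ (by omega)).trans ht.2
    · exact (Nat.le_mul_of_pos_left _ (by omega)).trans ht.2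
  · rintro ⟨-, rfl⟩
    exact ⟨rfl, by omega⟩

/-- The arithmetic function `n ↦ n * density M n`. -/
noncomputable def densityFun (M : ℕ) : ArithmeticFunction ℝ := ⟨fun n => n * density M n, by simp⟩

theorem densityFun_isMultiplicative (M : ℕ) : (densityFun M).IsMultiplicative := by
  refine ⟨by simp [densityFun], fun {m n} _ => ?_⟩
  simp only [densityFun, ArithmeticFunction.coe_mk, map_mul]
  push_cast
  ring

theorem densityFun_nonneg (M n : ℕ) : 0 ≤ densityFun M n :=
  mul_nonneg n.cast_nonneg (density_nonneg M n)

theorem densityFun_prime_pow (M : ℕ) {p : ℕ} (hp : p.Prime) (k : ℕ) :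
    densityFun M (p ^ k) = (if p ∣ M then 1 else 2 : ℝ) ^ k := by
  have : (p : ℝ) ≠ 0 := by exact_mod_cast hp.ne_zero
  simp only [densityFun, ArithmeticFunction.coe_mk, map_pow]
  push_cast
  rw [density_prime M hp, ← mul_pow, mul_div_cancel₀ _ this]

/-- The indicator function of the integers all of whose prime factors divide `M`. -/
noncomputable def supportedFun (M : ℕ) : ArithmeticFunction ℝ :=
  ⟨fun n => if n = 0 then 0 else if n.primeFactors ⊆ M.primeFactors then 1 else 0, by simp⟩

theorem supportedFun_nonneg (M n : ℕ) : 0 ≤ supportedFun M n := by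
  simp only [supportedFun, ArithmeticFunction.coe_mk]
  split_ifs <;> norm_num

theorem supportedFun_isMultiplicative (M : ℕ) : (supportedFun M).IsMultiplicative := by
  refine ⟨by simp [supportedFun], fun {m n} hmn => ?_⟩
  simp only [supportedFun, ArithmeticFunction.coe_mk]
  by_cases hm : m = 0
  · simp [hm]
  by_cases hn : n = 0
  · simp [hn]
  rw [if_neg hm, if_neg hn, if_neg (mul_ne_zero hm hn)]
  simp only [Nat.primeFactors_mul hm hn, union_subset_iff]
  by_cases h1 : m.primeFactors ⊆ M.primeFactors <;> by_cases h2 : n.primeFactors ⊆ M.primeFactors <;>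
    simp [h1, h2]

theorem le_of_le_prime_pow {f g : ArithmeticFunction ℝ} (hf : f.IsMultiplicative)
    (hg : g.IsMultiplicative) (hf0 : ∀ n, 0 ≤ f n)
    (h : ∀ p k : ℕ, p.Prime → f (p ^ k) ≤ g (p ^ k)) (n : ℕ) : f n ≤ g n := by
  by_cases hn : n = 0
  · simp [hn]
  rw [hf.multiplicative_factorization _ hn, hg.multiplicative_factorization _ hn]
  exact prod_le_prod (fun _ _ => hf0 _) fun p hp =>
    h p _ (Nat.prime_of_mem_primeFactors (by simpa using hp))

theorem mul_apply_prime_pow (f g : ArithmeticFunction ℝ) {p : ℕ} (hp : p.Prime) (k : ℕ) :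
    (f * g) (p ^ k) = ∑ i ∈ range (k + 1), f (p ^ i) * g (p ^ (k - i)) := by
  rw [ArithmeticFunction.mul_apply, Nat.sum_divisorsAntidiagonal fun x y => f x * g y,
    Nat.sum_divisors_prime_pow hp]
  refine sum_congr rfl fun i hi => ?_
  rw [Nat.pow_div (by rw [mem_range] at hi; omega) hp.pos]

theorem zeta_mul_zeta_le {M : ℕ} (hM : M ≠ 0) (n : ℕ) :
    ((ArithmeticFunction.zeta : ArithmeticFunction ℝ) * (ArithmeticFunction.zeta)) n ≤
      (densityFun M * supportedFun M) n := by
  have hz := ArithmeticFunction.isMultiplicative_zeta.natCast (R := ℝ)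
  refine le_of_le_prime_pow (hz.mul hz)
    ((densityFun_isMultiplicative M).mul (supportedFun_isMultiplicative M)) ?_ ?_ n
  · intro n
    rw [ArithmeticFunction.mul_apply]
    refine sum_nonneg fun x _ => mul_nonneg ?_ ?_ <;>
      simp only [ArithmeticFunction.natCoe_apply] <;> positivity
  · intro p k hp
    have hz1 : ∀ i, (ArithmeticFunction.zeta : ArithmeticFunction ℝ) (p ^ i) = 1 := by
      intro i
      simp [hp.ne_zero]
    rw [mul_apply_prime_pow _ _ hp, mul_apply_prime_pow _ _ hp]
    by_cases h : p ∣ M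
    · refine sum_le_sum fun i _ => ?_
      rw [hz1, hz1, densityFun_prime_pow M hp, if_pos h, one_pow]
      gcongr
      rw [supportedFun, ArithmeticFunction.coe_mk, if_neg (pow_ne_zero _ hp.ne_zero), if_pos]
      intro q hq
      rw [Nat.mem_primeFactors] at hq ⊢
      rw [(Nat.prime_dvd_prime_iff_eq hq.1 hp).1 (hq.1.dvd_of_dvd_pow hq.2.1)]
      exact ⟨hp, h, hM⟩
    · have h2 : (densityFun M (p ^ k)) * supportedFun M (p ^ (k - k)) ≤
          ∑ i ∈ range (k + 1), densityFun M (p ^ i) * supportedFun M (p ^ (k - i)) :=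
        single_le_sum (f := fun i => densityFun M (p ^ i) * supportedFun M (p ^ (k - i)))
          (fun i _ => mul_nonneg (densityFun_nonneg _ _) (supportedFun_nonneg _ _))
          (self_mem_range_succ k)
      refine le_trans ?_ h2
      simp only [hz1, tsub_self, pow_zero, (supportedFun_isMultiplicative M).map_one, mul_one,
        densityFun_prime_pow M hp, if_neg h, sum_const, card_range, nsmul_eq_mul]
      exact_mod_cast Nat.lt_two_pow_self

theorem sq_sum_inv_le {M r R : ℕ} (hM : M ≠ 0) (hr : r ^ 2 ≤ R) :
    (∑ u ∈ Icc 1 r, (u : ℝ)⁻¹) ^ 2 ≤ (∑ n ∈ Icc 1 R, density M n) * ((M : ℝ) / Nat.totient M) := by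
  have hpair : ∀ (F G : ArithmeticFunction ℝ) (t : ℕ),
      (t : ℝ)⁻¹ * (F * G) t = ∑ x ∈ t.divisorsAntidiagonal,
        ((x.1 : ℝ)⁻¹ * F x.1) * ((x.2 : ℝ)⁻¹ * G x.2) := by
    intro F G t
    rw [ArithmeticFunction.mul_apply, mul_sum]
    refine sum_congr rfl fun x hx => ?_
    rw [← (Nat.mem_divisorsAntidiagonal.1 hx).1]
    push_cast
    rw [mul_inv]
    ring
  calc (∑ u ∈ Icc 1 r, (u : ℝ)⁻¹) ^ 2
      = ∑ x ∈ Icc 1 r ×ˢ Icc 1 r, (x.1 : ℝ)⁻¹ * (x.2 : ℝ)⁻¹ := by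
        rw [sq, sum_mul_sum, sum_product]
    _ ≤ ∑ x ∈ Icc 1 R ×ˢ Icc 1 R with x.1 * x.2 ≤ R, (x.1 : ℝ)⁻¹ * (x.2 : ℝ)⁻¹ := by
        apply sum_le_sum_of_subset_of_nonneg
        · intro x hx
          simp only [mem_filter, mem_product, mem_Icc] at hx ⊢
          have h1 : x.1 * x.2 ≤ r * r := Nat.mul_le_mul hx.1.2 hx.2.2
          have h2 : r ≤ r * r := by nlinarith
          refine ⟨⟨⟨hx.1.1, ?_⟩, ⟨hx.2.1, ?_⟩⟩, ?_⟩ <;> nlinarith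
        · intros; positivity
    _ = ∑ t ∈ Icc 1 R, (t : ℝ)⁻¹ *
          ((ArithmeticFunction.zeta : ArithmeticFunction ℝ) * (ArithmeticFunction.zeta)) t := by
        rw [← sum_Icc_sum_divisorsAntidiagonal]
        refine sum_congr rfl fun t _ => ?_
        rw [hpair]
        refine sum_congr rfl fun x hx => ?_
        have h0 := (Nat.mem_divisorsAntidiagonal.1 hx)
        have h1 : x.1 ≠ 0 := left_ne_zero_of_mul (h0.1 ▸ h0.2)
        have h2 : x.2 ≠ 0 := right_ne_zero_of_mul (h0.1 ▸ h0.2)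
        simp [h1, h2]
    _ ≤ ∑ t ∈ Icc 1 R, (t : ℝ)⁻¹ * (densityFun M * supportedFun M) t := by
        gcongr with t
        exact zeta_mul_zeta_le hM t
    _ = ∑ x ∈ Icc 1 R ×ˢ Icc 1 R with x.1 * x.2 ≤ R,
          ((x.1 : ℝ)⁻¹ * densityFun M x.1) * ((x.2 : ℝ)⁻¹ * supportedFun M x.2) := by
        rw [← sum_Icc_sum_divisorsAntidiagonal]
        exact sum_congr rfl fun t _ => hpair _ _ t
    _ ≤ ∑ x ∈ Icc 1 R ×ˢ Icc 1 R,
          ((x.1 : ℝ)⁻¹ * densityFun M x.1) * ((x.2 : ℝ)⁻¹ * supportedFun M x.2) := by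
        apply sum_le_sum_of_subset_of_nonneg (filter_subset _ _)
        intro x _ _
        have := densityFun_nonneg M x.1
        have := supportedFun_nonneg M x.2
        positivity
    _ = (∑ n ∈ Icc 1 R, (n : ℝ)⁻¹ * densityFun M n) *
          ∑ b ∈ Icc 1 R, (b : ℝ)⁻¹ * supportedFun M b := by
        rw [sum_mul_sum, sum_product]
    _ = (∑ n ∈ Icc 1 R, density M n) *
          ∑ b ∈ Icc 1 R, (if b.primeFactors ⊆ M.primeFactors then (b : ℝ)⁻¹ else 0) := by
        congr 1
        · refine sum_congr rfl fun n hn => ?_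
          have : (n : ℝ) ≠ 0 := by
            have := (mem_Icc.1 hn).1
            exact_mod_cast (by omega : n ≠ 0)
          simp only [densityFun, ArithmeticFunction.coe_mk]
          field_simp
        · refine sum_congr rfl fun n hn => ?_
          have : n ≠ 0 := by have := (mem_Icc.1 hn).1; omega
          simp [supportedFun, this]
    _ ≤ _ := by
        gcongr
        · exact sum_nonneg fun n _ => density_nonneg M n
        · exact sum_inv_factoredNumbers_le hM R

theorem log_sq_le_sum_density {M r R : ℕ} (hM : M ≠ 0) (hr : r ^ 2 ≤ R) :
    log (r + 1) ^ 2 ≤ (∑ n ∈ Icc 1 R, density M n) * ((M : ℝ) / Nat.totient M) := by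
  refine le_trans ?_ (sq_sum_inv_le hM hr)
  have h := log_add_one_le_harmonic r
  rw [harmonic_eq_sum_Icc] at h
  push_cast at h
  have h0 : 0 ≤ log ((r : ℝ) + 1) := log_nonneg (by linarith [(r.cast_nonneg : (0 : ℝ) ≤ r)])
  gcongr

/-- Lower bound for Selberg's sum attached to the density of two linear forms. -/
theorem log_sq_le_selbergSum {M r R : ℕ} (hM : M ≠ 0) (h2 : 2 ∣ M) (hr : r ^ 2 ≤ R)
    (s : BoundingSieve) (hP : s.prodPrimes = primorial R) (hnu : ∀ d, s.nu d = density M d) :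
    log (r + 1) ^ 2 ≤ selbergSum s R * ((M : ℝ) / Nat.totient M) := by
  refine (log_sq_le_sum_density hM hr).trans ?_
  gcongr
  refine (sum_le_sum_mul_prod_geometric (density_nonneg M)
    (fun p hp => density_prime_lt_one h2 hp) R).trans (le_of_eq ?_)
  unfold selbergSum
  rw [hP]
  refine sum_congr rfl fun l _ => ?_
  rw [selbergTerms_apply]
  simp only [hnu]

/-- The number of solutions of `x (b x - a) = 0` modulo `d`. -/
noncomputable def rootCard (b : ℕ) (a : ℤ) (d : ℕ) : ℕ :=
  Nat.card {x : ZMod d // x * ((b : ZMod d) * x - (a : ZMod d)) = 0}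

theorem rootCard_mul (b : ℕ) (a : ℤ) {m n : ℕ} (h : m.Coprime n) :
    rootCard b a (m * n) = rootCard b a m * rootCard b a n := by
  unfold rootCard
  rw [← Nat.card_prod]
  refine Nat.card_congr (((ZMod.chineseRemainder h).toEquiv.subtypeEquiv
    (q := fun x => x.1 * ((b : ZMod m) * x.1 - (a : ZMod m)) = 0 ∧
      x.2 * ((b : ZMod n) * x.2 - (a : ZMod n)) = 0) fun x => ?_).trans
    (Equiv.subtypeProdEquivProd (p := fun x => x * ((b : ZMod m) * x - (a : ZMod m)) = 0)
      (q := fun x => x * ((b : ZMod n) * x - (a : ZMod n)) = 0)))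
  rw [← (ZMod.chineseRemainder h).map_eq_zero_iff, Prod.ext_iff]
  simp

theorem rootCard_prime {b : ℕ} {a : ℤ} (hco : b.Coprime a.natAbs) {p : ℕ} (hp : p.Prime) :
    rootCard b a p = if p ∣ b * a.natAbs then 1 else 2 := by
  have := Fact.mk hp
  have hb : (b : ZMod p) = 0 ↔ p ∣ b := ZMod.natCast_eq_zero_iff b p
  have ha : (a : ZMod p) = 0 ↔ p ∣ a.natAbs := by
    rw [ZMod.intCast_zmod_eq_zero_iff_dvd, Int.natCast_dvd]
  have hset : rootCard b a p =
      ({x : ZMod p | x * ((b : ZMod p) * x - (a : ZMod p)) = 0}).ncard := rfl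
  simp only [hset, hp.dvd_mul, ← hb, ← ha]
  by_cases hb0 : (b : ZMod p) = 0
  · have ha0 : (a : ZMod p) ≠ 0 := by
      intro ha0
      exact Nat.not_coprime_of_dvd_of_dvd hp.one_lt (hb.1 hb0) (ha.1 ha0) hco
    have : {x : ZMod p | x * ((b : ZMod p) * x - (a : ZMod p)) = 0} = {0} := by
      ext x; simp [hb0, ha0]
    rw [this, Set.ncard_singleton, if_pos (Or.inl hb0)]
  · by_cases ha0 : (a : ZMod p) = 0
    · have : {x : ZMod p | x * ((b : ZMod p) * x - (a : ZMod p)) = 0} = {0} := by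
        ext x; simp [hb0, ha0]
      rw [this, Set.ncard_singleton, if_pos (Or.inr ha0)]
    · have : {x : ZMod p | x * ((b : ZMod p) * x - (a : ZMod p)) = 0} =
          {0, (a : ZMod p) / (b : ZMod p)} := by
        ext x
        simp only [Set.mem_ofPred_eq, mul_eq_zero, Set.mem_insert_iff, Set.mem_singleton_iff]
        rw [sub_eq_zero, eq_div_iff hb0, mul_comm]
      rw [this, Set.ncard_pair, if_neg (by tauto)]
      exact (div_ne_zero ha0 hb0).symm

theorem density_eq_rootCard_div {b : ℕ} {a : ℤ} (hco : b.Coprime a.natAbs) {d : ℕ}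
    (hd : Squarefree d) : density (b * a.natAbs) d = rootCard b a d / d := by
  induction d using induction_on_primes with
  | zero => simp at hd
  | one =>
    have : rootCard b a 1 = 1 := by
      unfold rootCard
      rw [Nat.card_eq_one_iff_unique]
      exact ⟨⟨fun x y => Subtype.ext (Subsingleton.elim _ _)⟩, ⟨⟨0, by simp⟩⟩⟩
    simp [this]
  | prime_mul p m hp ih =>
    have h := Nat.squarefree_mul_iff.1 hd
    rw [map_mul, ih h.2.2, rootCard_mul b a h.1, rootCard_prime hco hp, density_prime _ hp]
    have : (p : ℝ) ≠ 0 := by exact_mod_cast hp.ne_zero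
    push_cast
    rw [div_mul_div_comm]

theorem rootCard_le (b : ℕ) (a : ℤ) {d : ℕ} (hd : d ≠ 0) : rootCard b a d ≤ d := by
  have := NeZero.mk hd
  calc rootCard b a d ≤ Nat.card (ZMod d) := Finite.card_subtype_le _
    _ = d := Nat.card_zmod d

theorem one_le_rootCard (b : ℕ) (a : ℤ) {d : ℕ} (hd : d ≠ 0) : 1 ≤ rootCard b a d := by
  have := NeZero.mk hd
  have : Nonempty {x : ZMod d // x * ((b : ZMod d) * x - (a : ZMod d)) = 0} := ⟨⟨0, by simp⟩⟩
  exact Nat.card_pos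

theorem abs_card_filter_sub_le {d : ℕ} [NeZero d] (A : Finset (ZMod d)) (N : ℕ) :
    |(#((range N).filter fun n : ℕ => (n : ZMod d) ∈ A) : ℝ) - #A / d * N| ≤ #A := by
  have hd : (0 : ℝ) < d := by exact_mod_cast Nat.pos_of_ne_zero (NeZero.ne d)
  have h1 : #((range N).filter fun n : ℕ => (n : ZMod d) ∈ A) = ∑ r ∈ A, #((range N).filter fun n : ℕ => (n : ZMod d) = r) := by
    rw [card_eq_sum_card_fiberwise (f := fun n : ℕ => (n : ZMod d)) (t := A)]
    · refine sum_congr rfl fun r hr => ?_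
      congr 1
      ext n
      simp only [mem_filter]
      constructor
      · rintro ⟨⟨h, -⟩, h'⟩; exact ⟨h, h'⟩
      · rintro ⟨h, h'⟩; exact ⟨⟨h, h' ▸ hr⟩, h'⟩
    · intro n hn
      simpa using (mem_filter.1 hn).2
  have h2 : ∀ r : ZMod d, |(#((range N).filter fun n : ℕ => (n : ZMod d) = r) : ℝ) - N / d| ≤ 1 := by
    intro r
    have h3 : #((range N).filter fun n : ℕ => (n : ZMod d) = r) = N.count (· ≡ r.val [MOD d]) := by
      rw [Nat.count_eq_card_filter_range]
      congr 1
      ext n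
      simp only [mem_filter, and_congr_right_iff]
      intro _
      rw [← ZMod.natCast_eq_natCast_iff, ZMod.natCast_zmod_val]
    rw [h3, Nat.count_modEq_card _ (Nat.pos_of_ne_zero (NeZero.ne d))]
    have h4 := Nat.div_add_mod N d
    have h5 := Nat.mod_lt N (Nat.pos_of_ne_zero (NeZero.ne d))
    have h6 : (N : ℝ) / d = (N / d : ℕ) + ((N % d : ℕ) : ℝ) / d := by
      rw [div_eq_iff hd.ne', add_mul, div_mul_cancel₀ _ hd.ne']
      exact_mod_cast (by rw [mul_comm]; exact h4.symm)
    have h7 : ((N % d : ℕ) : ℝ) / d ≤ 1 := by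
      rw [div_le_one hd]; exact_mod_cast h5.le
    have h8 : 0 ≤ ((N % d : ℕ) : ℝ) / d := by positivity
    rw [h6, abs_le]
    split_ifs <;> push_cast <;> constructor <;> linarith
  have h3 : (#((range N).filter fun n : ℕ => (n : ZMod d) ∈ A) : ℝ) - #A / d * N =
      ∑ r ∈ A, ((#((range N).filter fun n : ℕ => (n : ZMod d) = r) : ℝ) - N / d) := by
    rw [sum_sub_distrib, sum_const, h1, nsmul_eq_mul]
    push_cast
    ring
  rw [h3]
  refine (abs_sum_le_sum_abs _ _).trans ((sum_le_sum fun r _ => h2 r).trans ?_)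
  simp

/-- The integer `n (b n - a)`, up to sign. -/
def formProd (b : ℕ) (a : ℤ) (n : ℕ) : ℕ := ((n : ℤ) * (b * n - a)).natAbs

theorem abs_card_dvd_formProd_sub_le (b : ℕ) (a : ℤ) {d : ℕ} (hd : d ≠ 0) (N : ℕ) :
    |(#{n ∈ range N | d ∣ formProd b a n} : ℝ) - rootCard b a d / d * N| ≤ d := by
  have := NeZero.mk hd
  have h := abs_card_filter_sub_le (d := d)
    ({x : ZMod d | x * ((b : ZMod d) * x - (a : ZMod d)) = 0} : Finset (ZMod d)) N
  have h1 : rootCard b a d =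
      #({x : ZMod d | x * ((b : ZMod d) * x - (a : ZMod d)) = 0} : Finset (ZMod d)) := by
    rw [rootCard, Nat.card_eq_fintype_card, Fintype.card_subtype]
  rw [← h1] at h
  refine (le_of_eq ?_).trans (h.trans (by exact_mod_cast rootCard_le b a hd))
  congr 4
  ext n
  simp only [mem_filter, mem_univ, true_and, and_congr_right_iff]
  intro _
  rw [formProd, ← Int.natCast_dvd, ← ZMod.intCast_zmod_eq_zero_iff_dvd]
  push_cast
  rfl

theorem sum_image_ite_card {α β : Type*} [DecidableEq β] (S : Finset α) (f : α → β) (q : β → Prop)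
    [DecidablePred q] :
    ∑ m ∈ S.image f, (if q m then (#{n ∈ S | f n = m} : ℝ) else 0) = #{n ∈ S | q (f n)} := by
  rw [card_filter]
  push_cast
  rw [sum_comp (fun m => if q m then (1 : ℝ) else 0) f]
  refine sum_congr rfl fun m _ => ?_
  split_ifs <;> simp

/-- The sieve problem of removing from `[0, N)` the integers `n` for which `n (b n - a)` has a
prime factor at most `R`. -/
noncomputable def formSieve (b : ℕ) (a : ℤ) (h2 : 2 ∣ b * a.natAbs) (N R : ℕ) : BoundingSieve where
  support := (range N).image (formProd b a)
  prodPrimes := primorial R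
  prodPrimes_squarefree := squarefree_primorial R
  weights m := #{n ∈ range N | formProd b a n = m}
  weights_nonneg _ := Nat.cast_nonneg _
  totalMass := N
  nu := ⟨density (b * a.natAbs), density_zero _⟩
  nu_mult := ⟨map_one (density _), fun _ => map_mul (density _) _ _⟩
  nu_pos_of_prime _ hp _ := density_prime_pos _ hp
  nu_lt_one_of_prime _ hp _ := density_prime_lt_one h2 hp

theorem card_coprime_primorial_le {b : ℕ} {a : ℤ} (hM : b * a.natAbs ≠ 0) (h2 : 2 ∣ b * a.natAbs)
    (hco : b.Coprime a.natAbs) (N : ℕ) {r : ℕ} (hr : 1 ≤ r) :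
    (#{n ∈ range N | (primorial (r ^ 2)).Coprime (formProd b a n)} : ℝ) ≤
      N * (((b * a.natAbs : ℕ) : ℝ) / Nat.totient (b * a.natAbs)) / log (r + 1) ^ 2 +
        (r : ℝ) ^ 16 := by
  set s := formSieve b a h2 N (r ^ 2) with hs
  have hR : 1 ≤ r ^ 2 := Nat.one_le_pow _ _ hr
  have h0 : ∀ d, d ∣ s.prodPrimes → d ≠ 0 := fun d hd => ne_zero_of_dvd_ne_zero prodPrimes_ne_zero hd
  have hnu : ∀ d, d ∣ s.prodPrimes → s.nu d = rootCard b a d / d := fun d hd =>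
    density_eq_rootCard_div hco (squarefree_of_dvd_prodPrimes hd)
  have h1 := siftedSum_le_selberg s hR (by
    intro d hd
    rw [hnu d hd, inv_div]
    apply div_le_self (Nat.cast_nonneg _)
    exact_mod_cast one_le_rootCard b a (h0 d hd)) (by
    intro d hd
    rw [rem, hnu d hd, multSum]
    have := sum_image_ite_card (range N) (formProd b a) (d ∣ ·)
    change |∑ m ∈ (range N).image (formProd b a),
      (if d ∣ m then (#{n ∈ range N | formProd b a n = m} : ℝ) else 0) - _ * (N : ℝ)| ≤ _
    rw [this]
    exact abs_card_dvd_formProd_sub_le b a (h0 d hd) N)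
  have h3 : s.siftedSum = #{n ∈ range N | (primorial (r ^ 2)).Coprime (formProd b a n)} :=
    sum_image_ite_card (range N) (formProd b a) ((primorial (r ^ 2)).Coprime ·)
  rw [h3] at h1
  refine h1.trans (add_le_add ?_ (le_of_eq ?_))
  · have hS := selbergSum_pos s hR
    have hlog : 0 < log ((r : ℝ) + 1) := log_pos (by
      have : (1 : ℝ) ≤ r := by exact_mod_cast hr
      linarith)
    have h4 := log_sq_le_selbergSum hM h2 le_rfl s rfl (fun _ => rfl)
    change (N : ℝ) / _ ≤ _
    rw [div_le_div_iff₀ hS (by positivity), mul_assoc]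
    gcongr
    rw [mul_comm]
    exact h4
  · push_cast
    rw [← pow_mul]

/-- The primes `q < N` such that `b q - a` is prime or equal to `1`. -/
noncomputable def primePairs (b : ℕ) (a : ℤ) (N : ℕ) : Finset ℕ :=
  (range N).filter fun q : ℕ =>
    q.Prime ∧ (((b : ℤ) * q - a).toNat.Prime ∨ (b : ℤ) * q - a = 1)

theorem card_primePairs_le_one {b : ℕ} {a : ℤ} (hb : b ≠ 0)
    (hco : ¬ b.Coprime a.natAbs) (N : ℕ) :
    #(primePairs b a N) ≤ 1 := by
  obtain ⟨g, hg, h1, h2⟩ := Nat.Prime.not_coprime_iff_dvd.1 hco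
  have h1' : (g : ℤ) ∣ b := Int.natCast_dvd_natCast.2 h1
  have h2' : (g : ℤ) ∣ a := Int.natCast_dvd.2 h2
  have key : ∀ q ∈ primePairs b a N,
      (b : ℤ) * q - a = g := by
    intro q hq
    have hd : (g : ℤ) ∣ (b : ℤ) * q - a := dvd_sub (h1'.mul_right _) h2'
    obtain ⟨-, -, h | h⟩ := mem_filter.1 hq
    · have h3 : 0 ≤ (b : ℤ) * q - a := by
        by_contra h4
        rw [Int.toNat_of_nonpos (by omega)] at h
        exact Nat.not_prime_zero h
      have h4 : ((((b : ℤ) * q - a).toNat : ℕ) : ℤ) = (b : ℤ) * q - a := Int.toNat_of_nonneg h3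
      rw [← h4, Int.natCast_dvd_natCast, Nat.prime_dvd_prime_iff_eq hg h] at hd
      rw [← h4, hd]
    · rw [h] at hd
      have := Int.natCast_dvd_natCast.1 (by exact_mod_cast hd : (g : ℤ) ∣ ((1 : ℕ) : ℤ))
      exact absurd (Nat.dvd_one.1 this) hg.ne_one
  rw [card_le_one]
  intro x hx y hy
  have h := (key x hx).trans (key y hy).symm
  have hb' : (b : ℤ) ≠ 0 := by exact_mod_cast hb
  have : (b : ℤ) * x = b * y := by linarith
  exact_mod_cast mul_left_cancel₀ hb' this

theorem card_primePairs_le_card_coprime {b : ℕ} {a : ℤ} (hb : b ≠ 0) (N : ℕ) {R : ℕ} (hR : 1 ≤ R) :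
    #(primePairs b a N) ≤
      #{n ∈ range N | (primorial R).Coprime (formProd b a n)} + (R + R) := by
  classical
  set A := primePairs b a N with hA
  have hpos : ∀ q ∈ A, 1 ≤ (b : ℤ) * q - a := by
    intro q hq
    obtain ⟨-, -, h | h⟩ := mem_filter.1 hq
    · by_contra h4
      rw [Int.toNat_of_nonpos (by omega)] at h
      exact Nat.not_prime_zero h
    · omega
  have hsub : A ⊆ ({n ∈ range N | (primorial R).Coprime (formProd b a n)} : Finset ℕ) ∪
      (({q ∈ A | q ≤ R} : Finset ℕ) ∪ ({q ∈ A | (b : ℤ) * q - a ≤ R} : Finset ℕ)) := by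
    intro q hq
    by_cases h1 : q ≤ R
    · exact mem_union_right _ (mem_union_left _ (mem_filter.2 ⟨hq, h1⟩))
    by_cases h2 : (b : ℤ) * q - a ≤ R
    · exact mem_union_right _ (mem_union_right _ (mem_filter.2 ⟨hq, h2⟩))
    refine mem_union_left _ (mem_filter.2 ⟨(mem_filter.1 hq).1, ?_⟩)
    obtain ⟨-, hqp, h | h⟩ := mem_filter.1 hq
    swap
    · exfalso; apply h2; rw [h]; exact_mod_cast hR
    refine Nat.coprime_of_dvd fun p hp hpR hpf => ?_
    have hpR' := hp.dvd_primorial_iff.1 hpR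
    have h3 := hpos q hq
    have h4 : formProd b a q = q * ((b : ℤ) * q - a).toNat := by
      rw [formProd, Int.natAbs_mul, Int.natAbs_natCast]
      congr 1
      omega
    rw [h4, hp.dvd_mul] at hpf
    rcases hpf with h5 | h5
    · rw [(Nat.prime_dvd_prime_iff_eq hp hqp).1 h5] at hpR'
      exact h1 hpR'
    · have := (Nat.prime_dvd_prime_iff_eq hp h).1 h5
      omega
  refine (card_le_card hsub).trans ((card_union_le _ _).trans ?_)
  gcongr
  refine (card_union_le _ _).trans ?_
  gcongr
  · calc #{q ∈ A | q ≤ R} ≤ #(Icc 1 R) := by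
          apply card_le_card
          intro q hq
          obtain ⟨h1, h2⟩ := mem_filter.1 hq
          exact mem_Icc.2 ⟨(mem_filter.1 h1).2.1.one_le, h2⟩
      _ = R := by simp
  · calc #(A.filter fun q : ℕ => (b : ℤ) * q - a ≤ R) ≤ #(Icc (1 : ℤ) R) := by
          apply card_le_card_of_injOn (fun q : ℕ => (b : ℤ) * q - a)
          · intro q hq
            obtain ⟨h1, h2⟩ := mem_filter.1 hq
            exact mem_coe.2 (mem_Icc.2 ⟨hpos q h1, h2⟩)
          · intro x _ y _ h
            have hb' : (b : ℤ) ≠ 0 := by exact_mod_cast hb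
            have : (b : ℤ) * x = b * y := by
              simp only at h
              linarith
            exact_mod_cast mul_left_cancel₀ hb' this
      _ = R := by simp

theorem log_sq_le_sqrt {w : ℝ} (hw : 1 ≤ w) : log w ^ 2 ≤ 16 * w ^ (1 / 2 : ℝ) := by
  have h0 : (0 : ℝ) ≤ w := by linarith
  have h1 : log w ≤ w ^ (1 / 4 : ℝ) / (1 / 4) := log_le_rpow_div h0 (by norm_num)
  have h2 : 0 ≤ log w := log_nonneg hw
  have h3 : w ^ (1 / 2 : ℝ) = (w ^ (1 / 4 : ℝ)) ^ 2 := by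
    rw [← rpow_natCast, ← rpow_mul h0]
    norm_num
  rw [h3]
  nlinarith

/-- Upper bound for the number of primes `q ≤ w` such that `b q - a` is prime or equal to `1`. -/
theorem card_primePairs_le {b : ℕ} {a : ℤ} (hb : b ≠ 0) (ha : a ≠ 0) (h2 : 2 ∣ b * a.natAbs)
    {w : ℝ} (hw : 2 ≤ w) :
    (#(primePairs b a (⌊w⌋₊ + 1)) : ℝ) ≤
      2112 * (((b * a.natAbs : ℕ) : ℝ) / Nat.totient (b * a.natAbs)) * (w / log w ^ 2) := by
  have hM : b * a.natAbs ≠ 0 := mul_ne_zero hb (Int.natAbs_ne_zero.2 ha)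
  set M := b * a.natAbs with hMdef
  have hMphi : 1 ≤ (M : ℝ) / Nat.totient M := by
    rw [one_le_div (by exact_mod_cast Nat.totient_pos.2 (Nat.pos_of_ne_zero hM))]
    exact_mod_cast Nat.totient_le M
  have hw0 : (0 : ℝ) ≤ w := by linarith
  have hlog : 0 < log w := log_pos (by linarith)
  have hsq := log_sq_le_sqrt (w := w) (by linarith)
  have hroot : w ^ (1 / 2 : ℝ) * w ^ (1 / 2 : ℝ) = w := by
    rw [← rpow_add (by linarith)]; norm_num
  have hwsq : w ^ (1 / 2 : ℝ) ≤ 16 * (w / log w ^ 2) := by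
    rw [← mul_div_assoc, le_div_iff₀ (by positivity)]
    calc w ^ (1 / 2 : ℝ) * log w ^ 2 ≤ w ^ (1 / 2 : ℝ) * (16 * w ^ (1 / 2 : ℝ)) := by gcongr
      _ = 16 * w := by rw [mul_left_comm, hroot]
  have hone : 1 ≤ w ^ (1 / 2 : ℝ) := one_le_rpow (by linarith) (by norm_num)
  have hpos : 0 ≤ w / log w ^ 2 := by positivity
  by_cases hco : b.Coprime a.natAbs
  swap
  · have h := card_primePairs_le_one hb hco (⌊w⌋₊ + 1)
    calc _ ≤ (1 : ℝ) := by exact_mod_cast h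
      _ ≤ 16 * (w / log w ^ 2) := hone.trans hwsq
      _ ≤ 2112 * 1 * (w / log w ^ 2) := by linarith
      _ ≤ _ := by gcongr
  set r := ⌊w ^ (1 / 32 : ℝ)⌋₊ with hr
  have hz : 1 ≤ w ^ (1 / 32 : ℝ) := one_le_rpow (by linarith) (by norm_num)
  have hr1 : 1 ≤ r := Nat.le_floor (by simpa using hz)
  have hrle : (r : ℝ) ≤ w ^ (1 / 32 : ℝ) := Nat.floor_le (by linarith)
  have hrpow : (r : ℝ) ^ 16 ≤ w ^ (1 / 2 : ℝ) := by
    calc (r : ℝ) ^ 16 ≤ (w ^ (1 / 32 : ℝ)) ^ 16 := by gcongr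
      _ = w ^ (1 / 2 : ℝ) := by
        rw [← rpow_natCast, ← rpow_mul hw0]; norm_num
  have hr2 : (r : ℝ) ^ 2 ≤ w ^ (1 / 2 : ℝ) := by
    refine le_trans ?_ hrpow
    exact pow_le_pow_right₀ (by exact_mod_cast hr1) (by norm_num)
  have hlogr : log w / 32 ≤ log (r + 1) := by
    have : log (w ^ (1 / 32 : ℝ)) ≤ log (r + 1) :=
      log_le_log (by linarith) (Nat.lt_floor_add_one _).le
    rw [log_rpow (by linarith)] at this
    linarith
  have h1 := card_primePairs_le_card_coprime (a := a) hb (⌊w⌋₊ + 1) (R := r ^ 2)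
    (Nat.one_le_pow _ _ hr1)
  have h3 := card_coprime_primorial_le hM h2 hco (⌊w⌋₊ + 1) hr1
  have hN : ((⌊w⌋₊ + 1 : ℕ) : ℝ) ≤ 2 * w := by
    push_cast
    linarith [Nat.floor_le hw0]
  have h4 : ((⌊w⌋₊ + 1 : ℕ) : ℝ) * ((M : ℝ) / Nat.totient M) / log (r + 1) ^ 2 ≤
      2048 * ((M : ℝ) / Nat.totient M) * (w / log w ^ 2) := by
    calc _ ≤ 2 * w * ((M : ℝ) / Nat.totient M) / (log w / 32) ^ 2 := by gcongr
      _ = _ := by field_simp; norm_num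
  calc _ ≤ ((#{n ∈ range (⌊w⌋₊ + 1) | (primorial (r ^ 2)).Coprime (formProd b a n)} +
        (r ^ 2 + r ^ 2) : ℕ) : ℝ) := by exact_mod_cast h1
    _ ≤ 2048 * ((M : ℝ) / Nat.totient M) * (w / log w ^ 2) + 4 * w ^ (1 / 2 : ℝ) := by
        push_cast
        linarith
    _ ≤ 2048 * ((M : ℝ) / Nat.totient M) * (w / log w ^ 2) + 64 * 1 * (w / log w ^ 2) := by
        linarith
    _ ≤ 2048 * ((M : ℝ) / Nat.totient M) * (w / log w ^ 2) +
        64 * ((M : ℝ) / Nat.totient M) * (w / log w ^ 2) := by gcongr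
    _ = _ := by ring

open scoped Classical in
/-- The integers `u ≤ N` of the form `q ^ e` with `q ≥ 2` and `e ≥ 2`. -/
noncomputable def properPowers (N : ℕ) : Finset ℕ :=
  {u ∈ range (N + 1) | ∃ q e : ℕ, 2 ≤ q ∧ 2 ≤ e ∧ q ^ e = u}

theorem card_properPowers_le (N : ℕ) : #(properPowers N) ≤ Nat.sqrt N * (Nat.log 2 N + 1) := by
  classical
  have hsub : properPowers N ⊆
      (Icc 1 (Nat.sqrt N) ×ˢ range (Nat.log 2 N + 1)).image (fun x => x.1 ^ x.2) := by
    intro u hu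
    obtain ⟨h1, q, e, hq, he, rfl⟩ := mem_filter.1 hu
    have h2 : q ^ e ≤ N := Nat.lt_succ_iff.1 (mem_range.1 h1)
    refine mem_image.2 ⟨(q, e), mem_product.2 ⟨mem_Icc.2 ⟨by omega, ?_⟩, mem_range.2 ?_⟩, rfl⟩
    · exact Nat.le_sqrt'.2 ((Nat.pow_le_pow_right (by omega) he).trans h2)
    · have h3 : 2 ^ e ≤ N := (Nat.pow_le_pow_left hq e).trans h2
      exact Nat.lt_succ_iff.2 (Nat.le_log_of_pow_le (by norm_num) h3)
  refine (card_le_card hsub).trans (card_image_le.trans ?_)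
  simp [card_product]

theorem card_properPowers_le_div_log_sq {w : ℝ} (hw : 2 ≤ w) :
    (#(properPowers ⌊w⌋₊) : ℝ) ≤ 648 * (w / log w ^ 2) := by
  have hw0 : (0 : ℝ) ≤ w := by linarith
  have hlog2 : 0.69 < log 2 := by linarith [log_two_gt_d9]
  have hlog : log 2 ≤ log w := log_le_log (by norm_num) hw
  have hlogpos : 0 < log w := by linarith
  have hfl : ((⌊w⌋₊ : ℕ) : ℝ) ≤ w := Nat.floor_le hw0
  have hfl0 : ⌊w⌋₊ ≠ 0 := by
    have : 1 ≤ ⌊w⌋₊ := Nat.le_floor (by push_cast; linarith)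
    omega
  have h1 : (Nat.sqrt ⌊w⌋₊ : ℝ) ≤ w ^ (1 / 2 : ℝ) := by
    rw [← sqrt_eq_rpow]
    exact (Real.nat_sqrt_le_real_sqrt).trans (sqrt_le_sqrt hfl)
  have h2 : (Nat.log 2 ⌊w⌋₊ : ℝ) * log 2 ≤ log w := by
    have : ((2 ^ Nat.log 2 ⌊w⌋₊ : ℕ) : ℝ) ≤ w :=
      le_trans (by exact_mod_cast Nat.pow_log_le_self 2 hfl0) hfl
    have h := log_le_log (by positivity) this
    push_cast at h
    rwa [log_pow] at h
  have h3 : (Nat.log 2 ⌊w⌋₊ : ℝ) + 1 ≤ 3 * log w := by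
    have h4 : (0 : ℝ) ≤ Nat.log 2 ⌊w⌋₊ := Nat.cast_nonneg _
    nlinarith
  have h4 : log w ≤ 6 * w ^ (1 / 6 : ℝ) := by
    have := log_le_rpow_div hw0 (ε := 1 / 6) (by norm_num)
    linarith
  have h5 : log w ^ 3 ≤ 216 * w ^ (1 / 2 : ℝ) := by
    calc log w ^ 3 ≤ (6 * w ^ (1 / 6 : ℝ)) ^ 3 := by gcongr
      _ = 216 * w ^ (1 / 2 : ℝ) := by
        rw [mul_pow, ← rpow_natCast (w ^ (1 / 6 : ℝ)), ← rpow_mul hw0]; norm_num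
  have hroot : w ^ (1 / 2 : ℝ) * w ^ (1 / 2 : ℝ) = w := by
    rw [← rpow_add (by linarith)]; norm_num
  have h6 : (#(properPowers ⌊w⌋₊) : ℝ) ≤ w ^ (1 / 2 : ℝ) * (3 * log w) := by
    calc (#(properPowers ⌊w⌋₊) : ℝ) ≤ (Nat.sqrt ⌊w⌋₊ : ℝ) * (Nat.log 2 ⌊w⌋₊ + 1) := by
          exact_mod_cast card_properPowers_le _
      _ ≤ _ := by gcongr
  refine h6.trans ?_
  rw [← mul_div_assoc, le_div_iff₀ (by positivity)]
  calc w ^ (1 / 2 : ℝ) * (3 * log w) * log w ^ 2 = 3 * w ^ (1 / 2 : ℝ) * log w ^ 3 := by ring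
    _ ≤ 3 * w ^ (1 / 2 : ℝ) * (216 * w ^ (1 / 2 : ℝ)) := by gcongr
    _ = 648 * w := by rw [mul_mul_mul_comm, hroot]; norm_num

theorem div_totient_mul_le {m n : ℕ} (hm : m ≠ 0) (hn : n ≠ 0) :
    ((m * n : ℕ) : ℝ) / Nat.totient (m * n) ≤
      ((m : ℝ) / Nat.totient m) * ((n : ℝ) / Nat.totient n) := by
  have h1 : 0 < Nat.totient m := Nat.totient_pos.2 (Nat.pos_of_ne_zero hm)
  have h2 : 0 < Nat.totient n := Nat.totient_pos.2 (Nat.pos_of_ne_zero hn)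
  rw [div_mul_div_comm]
  push_cast
  gcongr
  exact_mod_cast Nat.totient_super_multiplicative m n

/-- The largest prime factor of `n`. -/
def maxPrimeFactor (n : ℕ) : ℕ := n.primeFactors.sup id

theorem maxPrimeFactor_mem {n : ℕ} (hn : n.primeFactors.Nonempty) :
    maxPrimeFactor n ∈ n.primeFactors := by
  obtain ⟨p, hp, h⟩ := exists_mem_eq_sup _ hn id
  rw [maxPrimeFactor, h]
  exact hp

theorem le_maxPrimeFactor {n p : ℕ} (hp : p ∈ n.primeFactors) : p ≤ maxPrimeFactor n :=
  le_sup (f := id) hp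

/-- The positive integers `n ≤ y` with `k` distinct prime factors such that `s n - a` is prime or
equal to `1`. -/
noncomputable def shiftedSet (s : ℕ) (a : ℤ) (y : ℝ) (k : ℕ) : Finset ℕ :=
  (Icc 1 ⌊y⌋₊).filter fun n : ℕ => n.primeFactors.card = k ∧
    (((s : ℤ) * n - a).toNat.Prime ∨ (s : ℤ) * n - a = 1)

/-- The part of `n` coprime to its largest prime factor. -/
def cofactor (n : ℕ) : ℕ := ordCompl[maxPrimeFactor n] n

theorem cofactor_spec {n : ℕ} (hn : n ≠ 0) (hne : n.primeFactors.Nonempty) :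
    ∃ q e : ℕ, q.Prime ∧ 1 ≤ e ∧ n = q ^ e * cofactor n ∧ cofactor n ≠ 0 ∧
      (cofactor n).primeFactors.card = n.primeFactors.card - 1 ∧
      ∀ p ∈ (cofactor n).primeFactors, p ≤ q := by
  have hmem := maxPrimeFactor_mem hne
  have hp := Nat.prime_of_mem_primeFactors hmem
  have hpf : (cofactor n).primeFactors = n.primeFactors.erase (maxPrimeFactor n) :=
    primeFactors_ordCompl _ _
  refine ⟨maxPrimeFactor n, n.factorization (maxPrimeFactor n), hp,
    hp.factorization_pos_of_dvd hn (Nat.dvd_of_mem_primeFactors hmem),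
    (Nat.ordProj_mul_ordCompl_eq_self n _).symm, (Nat.ordCompl_pos _ hn).ne', ?_, ?_⟩
  · rw [hpf, card_erase_of_mem hmem]
  · intro p h
    rw [hpf] at h
    exact le_maxPrimeFactor (mem_of_mem_erase h)

theorem card_fiber_cofactor_le {s : ℕ} {a : ℤ} {y : ℝ} {k m : ℕ} (hs : s ≠ 0) (ha : a ≠ 0)
    (h2 : 2 ∣ s * a.natAbs) (hk : 1 ≤ k) (hm : m ≠ 0) (hmy : 2 * (m : ℝ) ≤ y) :
    (#{n ∈ shiftedSet s a y k | cofactor n = m} : ℝ) ≤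
      2760 * ((s : ℝ) / Nat.totient s * ((a.natAbs : ℝ) / Nat.totient a.natAbs)) * y *
        (1 / ((Nat.totient m : ℝ) * log (y / m) ^ 2)) := by
  classical
  have hm0 : (0 : ℝ) < m := by exact_mod_cast Nat.pos_of_ne_zero hm
  have hw : 2 ≤ y / m := by rwa [le_div_iff₀ hm0]
  have ha' := Int.natAbs_ne_zero.2 ha
  have hsub : #{n ∈ shiftedSet s a y k | cofactor n = m} ≤
      #(primePairs (s * m) a (⌊y / m⌋₊ + 1) ∪ properPowers ⌊y / m⌋₊) := by
    have key : ∀ n ∈ ({n ∈ shiftedSet s a y k | cofactor n = m} : Finset ℕ),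
        ∃ q e : ℕ, q.Prime ∧ 1 ≤ e ∧ n = q ^ e * m ∧ q ^ e ≤ ⌊y / m⌋₊ ∧
        (((s : ℤ) * n - a).toNat.Prime ∨ (s : ℤ) * n - a = 1) := by
      intro n hn
      obtain ⟨h1, rfl⟩ := mem_filter.1 hn
      obtain ⟨h3, h4, h5⟩ := mem_filter.1 h1
      obtain ⟨h6, h7⟩ := mem_Icc.1 h3
      obtain ⟨q, e, hq, he, hn', -, -, -⟩ := cofactor_spec (n := n) (by omega)
        (card_pos.1 (by omega))
      refine ⟨q, e, hq, he, hn', ?_, h5⟩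
      rw [Nat.le_floor_iff (by linarith), le_div_iff₀ hm0]
      have h8 : (n : ℝ) ≤ y := (Nat.le_floor_iff (by linarith)).1 h7
      calc ((q ^ e : ℕ) : ℝ) * cofactor n = n := by exact_mod_cast hn'.symm
        _ ≤ y := h8
    apply card_le_card_of_injOn (· / m)
    · intro n hn
      obtain ⟨q, e, hq, he, rfl, hle, h⟩ := key n hn
      simp only [Nat.mul_div_cancel _ (Nat.pos_of_ne_zero hm), coe_union, Set.mem_union, mem_coe]
      by_cases he1 : e = 1
      · left
        subst he1
        rw [pow_one] at hle h ⊢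
        refine mem_filter.2 ⟨mem_range.2 (by omega), hq, ?_⟩
        have : ((s * m : ℕ) : ℤ) * q - a = (s : ℤ) * ((q * m : ℕ) : ℤ) - a := by push_cast; ring
        rw [this]
        exact h
      · right
        exact mem_filter.2 ⟨mem_range.2 (by omega), q, e, hq.two_le, by omega, rfl⟩
    · intro x hx z hz hxz
      obtain ⟨q, e, -, -, hx', -⟩ := key x hx
      obtain ⟨q', e', -, -, hz', -⟩ := key z hz
      simp only [hx', hz', Nat.mul_div_cancel _ (Nat.pos_of_ne_zero hm)] at hxz
      rw [hx', hz', hxz]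
  have h3 := card_primePairs_le (b := s * m) (a := a) (mul_ne_zero hs hm) ha
    (h2.trans ⟨m, by ring⟩) hw
  have h4 := card_properPowers_le_div_log_sq hw
  have h5 : ((s * m * a.natAbs : ℕ) : ℝ) / Nat.totient (s * m * a.natAbs) ≤
      (s : ℝ) / Nat.totient s * ((m : ℝ) / Nat.totient m) *
        ((a.natAbs : ℝ) / Nat.totient a.natAbs) := by
    refine (div_totient_mul_le (mul_ne_zero hs hm) ha').trans ?_
    gcongr
    exact div_totient_mul_le hs hm
  have hone : 1 ≤ ((s * m * a.natAbs : ℕ) : ℝ) / Nat.totient (s * m * a.natAbs) := by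
    rw [one_le_div (by exact_mod_cast Nat.totient_pos.2 (by positivity))]
    exact_mod_cast Nat.totient_le _
  have hpos : 0 ≤ y / m / log (y / m) ^ 2 := by positivity
  calc (#{n ∈ shiftedSet s a y k | cofactor n = m} : ℝ)
      ≤ #(primePairs (s * m) a (⌊y / m⌋₊ + 1)) + #(properPowers ⌊y / m⌋₊) := by
        exact_mod_cast hsub.trans (card_union_le _ _)
    _ ≤ 2112 * (((s * m * a.natAbs : ℕ) : ℝ) / Nat.totient (s * m * a.natAbs)) *
          (y / m / log (y / m) ^ 2) + 648 * 1 * (y / m / log (y / m) ^ 2) := by linarith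
    _ ≤ 2112 * (((s * m * a.natAbs : ℕ) : ℝ) / Nat.totient (s * m * a.natAbs)) *
          (y / m / log (y / m) ^ 2) + 648 *
          (((s * m * a.natAbs : ℕ) : ℝ) / Nat.totient (s * m * a.natAbs)) *
          (y / m / log (y / m) ^ 2) := by gcongr
    _ = 2760 * (((s * m * a.natAbs : ℕ) : ℝ) / Nat.totient (s * m * a.natAbs)) *
          (y / m / log (y / m) ^ 2) := by ring
    _ ≤ 2760 * ((s : ℝ) / Nat.totient s * ((m : ℝ) / Nat.totient m) *
        ((a.natAbs : ℝ) / Nat.totient a.natAbs)) * (y / m / log (y / m) ^ 2) := by gcongr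
    _ = _ := by
        generalize log (y / m) = L
        field_simp

theorem exists_card_shiftedSet_le :
    ∃ K C : ℝ, 0 ≤ K ∧ 0 ≤ log (log 2) + C ∧ ∀ (s : ℕ) (a : ℤ) (y : ℝ) (k : ℕ), s ≠ 0 → a ≠ 0 →
      2 ∣ s * a.natAbs → 2 ≤ y → 1 ≤ k →
      (#(shiftedSet s a y k) : ℝ) ≤
        K * ((s : ℝ) / Nat.totient s * ((a.natAbs : ℝ) / Nat.totient a.natAbs)) * y *
          ((log (log y) + C) ^ (k - 1) / ((k - 1).factorial * log y ^ 2)) := by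
  obtain ⟨K, C, hK, hC, H⟩ := exists_sum_inv_totient_log_sq_le
  refine ⟨2760 * K, C, by positivity, hC, fun s a y k hs ha h2 hy hk => ?_⟩
  have hmem : ∀ m ∈ (shiftedSet s a y k).image cofactor, m ≠ 0 ∧ 2 * (m : ℝ) ≤ y ∧
      m.primeFactors.card = k - 1 ∧ ∀ p ∈ m.primeFactors, (p : ℝ) * m ≤ y := by
    intro m hm
    obtain ⟨n, hn, rfl⟩ := mem_image.1 hm
    obtain ⟨h3, h4, -⟩ := mem_filter.1 hn
    obtain ⟨h6, h7⟩ := mem_Icc.1 h3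
    have h8 : (n : ℝ) ≤ y := (Nat.le_floor_iff (by linarith)).1 h7
    obtain ⟨q, e, hq, he, hn', h0, hc, hle⟩ := cofactor_spec (n := n) (by omega)
      (card_pos.1 (by omega))
    have hqn : q * cofactor n ≤ n := by
      calc q * cofactor n ≤ q ^ e * cofactor n :=
            Nat.mul_le_mul_right _ (Nat.le_self_pow (by omega) q)
        _ = n := hn'.symm
    have hall : ∀ p, p ≤ q → (p : ℝ) * cofactor n ≤ y := fun p hp =>
      le_trans (by exact_mod_cast (Nat.mul_le_mul_right _ hp).trans hqn) h8
    exact ⟨h0, by exact_mod_cast hall 2 hq.two_le, by rw [hc, h4], fun p hp => hall p (hle p hp)⟩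
  rw [card_eq_sum_card_image cofactor]
  push_cast
  set A := (s : ℝ) / Nat.totient s * ((a.natAbs : ℝ) / Nat.totient a.natAbs) with hA
  have hA0 : 0 ≤ A := by positivity
  calc ∑ m ∈ (shiftedSet s a y k).image cofactor,
        (#{n ∈ shiftedSet s a y k | cofactor n = m} : ℝ)
      ≤ ∑ m ∈ (shiftedSet s a y k).image cofactor,
        2760 * A * y * (1 / ((Nat.totient m : ℝ) * log (y / m) ^ 2)) := sum_le_sum fun m hm =>
          card_fiber_cofactor_le hs ha h2 hk (hmem m hm).1 (hmem m hm).2.1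
    _ = 2760 * A * y * ∑ m ∈ (shiftedSet s a y k).image cofactor,
          1 / ((Nat.totient m : ℝ) * log (y / m) ^ 2) := by rw [mul_sum]
    _ ≤ 2760 * A * y * (K * ((log (log y) + C) ^ (k - 1) /
          ((k - 1).factorial * log y ^ 2))) := by
        gcongr
        exact H y (k - 1) _ hy hmem
    _ = _ := by ring

theorem le_primeCounting_mul_log {x : ℝ} (hx : 2 ≤ x) :
    x ≤ 10 * (Nat.primeCounting ⌊x⌋₊ * log x) := by
  have hlog2 : 0.69 < log 2 := by linarith [log_two_gt_d9]
  have hlog2' : log 2 < 0.694 := by linarith [log_two_lt_d9]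
  have hlog : log 2 ≤ log x := log_le_log (by norm_num) hx
  rcases le_total x 6 with h6 | h6
  · have h1 : 1 ≤ Nat.primeCounting ⌊x⌋₊ := by
      have h2 : 2 ≤ ⌊x⌋₊ := Nat.le_floor (by exact_mod_cast hx)
      have h3 : Nat.primeCounting 2 = 1 := by decide
      exact h3 ▸ Nat.monotone_primeCounting h2
    have h1' : (1 : ℝ) ≤ Nat.primeCounting ⌊x⌋₊ := by exact_mod_cast h1
    nlinarith
  · have h := Chebyshev.pi_ge' (x := x) (by linarith)
    rw [div_le_iff₀ (by linarith)] at h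
    have h8 : log (x + 2) ≤ 3 * log 2 + ((x + 2) / 8 - 1) := by
      have h9 := log_le_sub_one_of_pos (x := (x + 2) / 8) (by linarith)
      rw [log_div (by linarith) (by norm_num), show (8 : ℝ) = 2 ^ 3 by norm_num, log_pow] at h9
      push_cast at h9
      linarith
    nlinarith

theorem log_log_two_mul_le {x : ℝ} (hx : 2 ≤ x) : log (log (2 * x)) ≤ log (log x) + log 2 := by
  have hlog : log 2 ≤ log x := log_le_log (by norm_num) hx
  have h2 : 0 < log 2 := log_pos (by norm_num)
  rw [← log_mul (by linarith) (by norm_num), log_mul (by norm_num) (by linarith)]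
  exact log_le_log (by linarith) (by linarith)

theorem self_div_totient_ite_le (a : ℤ) :
    (((if Odd a then 2 else 1 : ℕ) : ℝ)) / Nat.totient (if Odd a then 2 else 1) ≤ 2 := by
  split_ifs <;> simp

theorem card_filter_prime_le_card_shiftedSet {a : ℤ} {x : ℝ} {k : ℕ}
    (hx : 2 * (a.natAbs : ℝ) ≤ x) (hk : 1 ≤ k) :
    #((Iic ⌊x⌋₊).filter fun p : ℕ => p.Prime ∧ -a < (p : ℤ) ∧
        (((p : ℤ) + a).toNat / (if Odd a then 2 else 1)).primeFactors.card = k) ≤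
      #(shiftedSet (if Odd a then 2 else 1) a (2 * x) k) := by
  have hx0 : 0 ≤ x := le_trans (by positivity) hx
  have key : ∀ p : ℕ, p.Prime → -a < (p : ℤ) →
      ((if Odd a then 2 else 1 : ℕ) : ℤ) * ((((p : ℤ) + a).toNat / (if Odd a then 2 else 1) : ℕ))
        - a = if Odd a ∧ p = 2 then 1 else (p : ℤ) := by
    intro p hp hpa
    by_cases ha : Odd a
    · obtain ⟨b, rfl⟩ := ha
      rcases hp.eq_two_or_odd' with rfl | ⟨c, rfl⟩
      · simp only [odd_two_mul_add_one, if_true, and_self]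
        omega
      · have : 2 * c + 1 ≠ 2 := by omega
        simp only [odd_two_mul_add_one, if_true, this, and_false, if_false]
        omega
    · simp only [ha, if_false, false_and]
      rw [Nat.div_one]
      omega
  refine card_le_card_of_injOn
    (fun p : ℕ => ((p : ℤ) + a).toNat / (if Odd a then 2 else 1)) ?_ ?_
  · intro p hp
    obtain ⟨hpx, hp, hpa, hc⟩ := mem_filter.1 hp
    have hk' := key p hp hpa
    refine mem_filter.2 ⟨mem_Icc.2 ⟨?_, Nat.le_floor ?_⟩, hc, ?_⟩
    · rw [Nat.one_le_iff_ne_zero]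
      intro h0
      simp only [h0, Nat.primeFactors_zero, card_empty] at hc
      omega
    · have h1 : (p : ℝ) ≤ x := (Nat.le_floor_iff hx0).1 (mem_Iic.1 hpx)
      have h2 : ((p : ℤ) + a).toNat / (if Odd a then 2 else 1) ≤ p + a.natAbs :=
        (Nat.div_le_self _ _).trans (by omega)
      have h3 : (((((p : ℤ) + a).toNat / (if Odd a then 2 else 1) : ℕ)) : ℝ) ≤ p + a.natAbs := by
        exact_mod_cast h2
      have h4 : (0 : ℝ) ≤ a.natAbs := Nat.cast_nonneg _
      linarith
    · rw [hk']
      split_ifs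
      · exact Or.inr rfl
      · exact Or.inl (by simpa using hp)
  · intro p hp q hq hpq
    obtain ⟨-, hp, hpa, -⟩ := mem_filter.1 hp
    obtain ⟨-, hq, hqa, -⟩ := mem_filter.1 hq
    have h1 := key p hp hpa
    have h2 := key q hq hqa
    have hpq' : ((p : ℤ) + a).toNat / (if Odd a then 2 else 1) =
      ((q : ℤ) + a).toNat / (if Odd a then 2 else 1) := hpq
    rw [hpq', h2] at h1
    have := hp.two_le
    have := hq.two_le
    split_ifs at h1 <;> omega

end ShiftedPrimes

open Finset

/-- Corollary 1: a Hardy–Ramanujan type bound for shifted primes `p + a`.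
Here `s = 2` if `a` is odd and `s = 1` if `a` is even. -/
theorem shifted_primes_HardyRamanujan :
    ∃ C₁ C₂ : ℝ, ∀ (a : ℤ) (x : ℝ) (k : ℕ),
      a ≠ 0 → 2 * (a.natAbs : ℝ) ≤ x → 1 ≤ k →
      (((Finset.Iic ⌊x⌋₊).filter
          (fun p : ℕ => p.Prime ∧ -a < (p : ℤ) ∧
            ((((p : ℤ) + a).toNat / (if Odd a then 2 else 1)).primeFactors.card = k))).card : ℝ)
        ≤ C₁ * ((a.natAbs : ℝ) / (Nat.totient a.natAbs : ℝ)) * (Nat.primeCounting ⌊x⌋₊ : ℝ) *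
            (Real.log (Real.log x) + C₂) ^ (k - 1) /
            ((Nat.factorial (k - 1) : ℝ) * Real.log x) := by
  obtain ⟨K, C, hK, hC, H⟩ := ShiftedPrimes.exists_card_shiftedSet_le
  refine ⟨40 * K, C + Real.log 2, fun a x k ha hx hk => ?_⟩
  have hx2 : 2 ≤ x := by
    have h1 : (1 : ℝ) ≤ a.natAbs := by
      exact_mod_cast Nat.one_le_iff_ne_zero.2 (Int.natAbs_ne_zero.2 ha)
    linarith
  have hs0 : (if Odd a then 2 else 1 : ℕ) ≠ 0 := by split_ifs <;> norm_num
  have hsa : 2 ∣ (if Odd a then 2 else 1 : ℕ) * a.natAbs := by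
    split_ifs with h
    · exact dvd_mul_right _ _
    · rw [one_mul]
      exact even_iff_two_dvd.1 (Int.natAbs_even.2 (Int.not_odd_iff_even.1 h))
  have hbound := H _ a (2 * x) k hs0 ha hsa (by linarith) hk
  have hs2 := ShiftedPrimes.self_div_totient_ite_le a
  have hlog2 : 0 < Real.log 2 := Real.log_pos (by norm_num)
  have hlog : 0 < Real.log x := Real.log_pos (by linarith)
  have hlog' : Real.log x ≤ Real.log (2 * x) := Real.log_le_log (by linarith) (by linarith)
  have hll : 0 ≤ Real.log (Real.log (2 * x)) + C := by
    have : Real.log (Real.log 2) ≤ Real.log (Real.log (2 * x)) :=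
      Real.log_le_log hlog2 (Real.log_le_log (by norm_num) (by linarith))
    linarith
  have hll' : Real.log (Real.log (2 * x)) + C ≤ Real.log (Real.log x) + (C + Real.log 2) := by
    linarith [ShiftedPrimes.log_log_two_mul_le hx2]
  have hpi := ShiftedPrimes.le_primeCounting_mul_log hx2
  have hxpos : 0 ≤ 2 * x := by linarith
  have hfact : (0 : ℝ) < (k - 1).factorial := by exact_mod_cast Nat.factorial_pos _
  set s : ℕ := if Odd a then 2 else 1
  set A : ℝ := (a.natAbs : ℝ) / (Nat.totient a.natAbs : ℝ) with hA
  have hA0 : 0 ≤ A := by positivity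
  have hfrac : (Real.log (Real.log (2 * x)) + C) ^ (k - 1) /
      ((k - 1).factorial * Real.log (2 * x) ^ 2) ≤
      (Real.log (Real.log x) + (C + Real.log 2)) ^ (k - 1) /
      ((k - 1).factorial * Real.log x ^ 2) := by
    have := pow_nonneg (hll.trans hll') (k - 1)
    gcongr
  have hfrac0 : 0 ≤ (Real.log (Real.log x) + (C + Real.log 2)) ^ (k - 1) /
      ((k - 1).factorial * Real.log x ^ 2) :=
    div_nonneg (pow_nonneg (hll.trans hll') _) (by positivity)
  calc _ ≤ (#(ShiftedPrimes.shiftedSet s a (2 * x) k) : ℝ) := by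
        exact_mod_cast ShiftedPrimes.card_filter_prime_le_card_shiftedSet hx hk
    _ ≤ _ := hbound
    _ ≤ K * (2 * A) * (2 * (10 * (Nat.primeCounting ⌊x⌋₊ * Real.log x))) *
        ((Real.log (Real.log x) + (C + Real.log 2)) ^ (k - 1) /
          ((k - 1).factorial * Real.log x ^ 2)) := by gcongr
    _ = _ := by
        generalize (Real.log (Real.log x) + (C + Real.log 2)) ^ (k - 1) = T
        field_simp
        ring
end

section
/- There exist absolute constants C₁ and C₂ such that for every set of primes ℰ, every real x ≥ 2, and every positive integer k, #{ n ≤ x : n ∈ 𝒬(ℰ) and ω(n) = k } ≤ C₁ · x · (E(x) + C₂)^{k−1} / ((k−1)! · log x). -/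
open Finset
open scoped Classical

/-- The integers `1 ≤ n ≤ N` with exactly `k` distinct prime factors, all of them in `E`. -/
noncomputable def omegaLevel (E : Set ℕ) (k N : ℕ) : Finset ℕ :=
  (Icc 1 N).filter (fun n => (∀ p ∈ n.primeFactors, p ∈ E) ∧ n.primeFactors.card = k)

/-- The prime powers `q ≤ N` whose prime lies in `E`. -/
noncomputable def primePowersIn (E : Set ℕ) (N : ℕ) : Finset ℕ :=
  (Ioc 0 N).filter (fun q => IsPrimePow q ∧ q.minFac ∈ E)

theorem mem_omegaLevel {E : Set ℕ} {k N n : ℕ} :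
    n ∈ omegaLevel E k N ↔
      (1 ≤ n ∧ n ≤ N) ∧ (∀ p ∈ n.primeFactors, p ∈ E) ∧ n.primeFactors.card = k := by
  simp [omegaLevel]

theorem mem_primePowersIn {E : Set ℕ} {N q : ℕ} :
    q ∈ primePowersIn E N ↔ (0 < q ∧ q ≤ N) ∧ IsPrimePow q ∧ q.minFac ∈ E := by
  simp [primePowersIn]

/-- Splitting off a full prime power `p ^ v_p(n)` from each `n` with `ω(n) = k + 1`. -/
theorem sum_omegaLevel_succ_le (E : Set ℕ) (k N : ℕ) (f : ℕ → ℕ → ℝ)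
    (hf : ∀ q m, 0 ≤ f q m) :
    ∑ n ∈ omegaLevel E (k + 1) N, ∑ p ∈ n.primeFactors, f (ordProj[p] n) (ordCompl[p] n) ≤
      ∑ m ∈ omegaLevel E k N, ∑ q ∈ primePowersIn E (N / m), f q m := by
  rw [sum_sigma', sum_sigma']
  let i : (Σ _ : ℕ, ℕ) → (Σ _ : ℕ, ℕ) := fun s => ⟨ordCompl[s.2] s.1, ordProj[s.2] s.1⟩
  have hprop : ∀ s ∈ (omegaLevel E (k + 1) N).sigma (fun n => n.primeFactors),
      s.2.Prime ∧ s.2 ∣ s.1 ∧ s.1 ≠ 0 ∧ s.1.factorization s.2 ≠ 0 := by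
    rintro ⟨n, p⟩ hs
    obtain ⟨-, h2⟩ := mem_sigma.1 hs
    obtain ⟨hp, hd, h0⟩ := Nat.mem_primeFactors.1 h2
    exact ⟨hp, hd, h0, (hp.factorization_pos_of_dvd h0 hd).ne'⟩
  have hinj : Set.InjOn i ((omegaLevel E (k + 1) N).sigma (fun n => n.primeFactors)) := by
    rintro ⟨n, p⟩ hs ⟨n', p'⟩ hs' h
    obtain ⟨hp, -, -, hv⟩ := hprop _ hs
    obtain ⟨hp', -, -, hv'⟩ := hprop _ hs'
    simp only [i, Sigma.mk.injEq, heq_eq_eq] at h hv hv' hp hp'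
    have hn : n = n' := by
      rw [← Nat.ordProj_mul_ordCompl_eq_self n p, ← Nat.ordProj_mul_ordCompl_eq_self n' p',
        h.1, h.2]
    have hpp : p = p' := by
      rw [← hp.pow_minFac hv, ← hp'.pow_minFac hv', h.2]
    subst hn hpp
    rfl
  have himg : ((omegaLevel E (k + 1) N).sigma (fun n => n.primeFactors)).image i ⊆
      (omegaLevel E k N).sigma (fun m => primePowersIn E (N / m)) := by
    intro t ht
    obtain ⟨⟨n, p⟩, hs, rfl⟩ := mem_image.1 ht
    obtain ⟨hp, hd, h0, hv⟩ := hprop _ hs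
    obtain ⟨h1, h2⟩ := mem_sigma.1 hs
    obtain ⟨⟨hn1, hnN⟩, hE, hc⟩ := mem_omegaLevel.1 h1
    simp only at hp hd h0 hv hn1 hnN hE hc h2
    have hpos : 0 < ordCompl[p] n := Nat.ordCompl_pos p h0
    have hfac : (ordCompl[p] n).primeFactors = n.primeFactors.erase p := by
      rw [← Nat.support_factorization, Nat.factorization_ordCompl, Finsupp.support_erase,
        Nat.support_factorization]
    refine mem_sigma.2 ⟨mem_omegaLevel.2 ⟨⟨hpos, ?_⟩, ?_, ?_⟩,
      mem_primePowersIn.2 ⟨⟨pow_pos hp.pos _, ?_⟩, hp.isPrimePow.pow hv, ?_⟩⟩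
    · exact (Nat.div_le_self _ _).trans hnN
    · intro r hr
      simp only [i] at hr
      rw [hfac] at hr
      exact hE r (mem_of_mem_erase hr)
    · simp only [i]
      rw [hfac, card_erase_of_mem h2, hc]
      rfl
    · simp only [i]
      rw [Nat.le_div_iff_mul_le hpos, Nat.ordProj_mul_ordCompl_eq_self]
      exact hnN
    · simp only [i]
      rw [hp.pow_minFac hv]
      exact hE p h2
  calc _ = ∑ t ∈ ((omegaLevel E (k + 1) N).sigma (fun n => n.primeFactors)).image i,
        f t.2 t.1 := (sum_image (g := i) (f := fun t => f t.2 t.1) hinj).symm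
    _ ≤ _ := sum_le_sum_of_subset_of_nonneg himg fun t _ _ => hf _ _

theorem sum_inv_omegaLevel_le (E : Set ℕ) (N k : ℕ) :
    ∑ n ∈ omegaLevel E k N, (1 : ℝ) / n ≤
      (∑ q ∈ primePowersIn E N, (1 : ℝ) / q) ^ k / (k.factorial : ℝ) := by
  induction k with
  | zero =>
    have hsub : omegaLevel E 0 N ⊆ {1} := by
      intro n hn
      obtain ⟨⟨h1, -⟩, -, hc⟩ := mem_omegaLevel.1 hn
      rw [card_eq_zero, Nat.primeFactors_eq_empty] at hc
      simp; omega
    calc _ ≤ ∑ n ∈ ({1} : Finset ℕ), (1 : ℝ) / n :=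
          sum_le_sum_of_subset_of_nonneg hsub fun _ _ _ => by positivity
      _ = _ := by simp
  | succ k ih =>
    set R := ∑ q ∈ primePowersIn E N, (1 : ℝ) / q with hR
    have hR0 : 0 ≤ R := sum_nonneg fun _ _ => by positivity
    have h := sum_omegaLevel_succ_le E k N (fun q m => 1 / q * (1 / m))
      (fun _ _ => by positivity)
    have hl : ∑ n ∈ omegaLevel E (k + 1) N, ∑ p ∈ n.primeFactors,
        (1 : ℝ) / (ordProj[p] n : ℕ) * (1 / (ordCompl[p] n : ℕ)) =
        (k + 1) * ∑ n ∈ omegaLevel E (k + 1) N, (1 : ℝ) / n := by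
      rw [mul_sum]
      refine sum_congr rfl fun n hn => ?_
      obtain ⟨-, -, hc⟩ := mem_omegaLevel.1 hn
      have : ∀ p ∈ n.primeFactors,
          (1 : ℝ) / (ordProj[p] n : ℕ) * (1 / (ordCompl[p] n : ℕ)) = 1 / n := by
        intro p _
        rw [one_div_mul_one_div, ← Nat.cast_mul, Nat.ordProj_mul_ordCompl_eq_self]
      rw [sum_congr rfl this, sum_const, hc, nsmul_eq_mul]
      push_cast; rfl
    have hr : ∑ m ∈ omegaLevel E k N, ∑ q ∈ primePowersIn E (N / m), (1 : ℝ) / q * (1 / m) ≤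
        R * ∑ m ∈ omegaLevel E k N, (1 : ℝ) / m := by
      rw [mul_sum]
      refine sum_le_sum fun m _ => ?_
      rw [← sum_mul]
      gcongr
      refine sum_le_sum_of_subset_of_nonneg (fun q hq => ?_) fun _ _ _ => by positivity
      rw [mem_primePowersIn] at hq ⊢
      exact ⟨⟨hq.1.1, hq.1.2.trans (Nat.div_le_self _ _)⟩, hq.2⟩
    have h2 : (k + 1 : ℝ) * ∑ n ∈ omegaLevel E (k + 1) N, (1 : ℝ) / n ≤
        R * (R ^ k / k.factorial) :=
      hl ▸ h.trans (hr.trans (mul_le_mul_of_nonneg_left ih hR0))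
    rw [Nat.factorial_succ, pow_succ, le_div_iff₀ (by positivity)]
    have hk : (0 : ℝ) < k.factorial := by positivity
    rw [← mul_div_assoc, le_div_iff₀ hk] at h2
    push_cast
    linarith

theorem sum_log_primePow_le : ∃ C : ℝ, 0 ≤ C ∧ ∀ N : ℕ,
    ∑ q ∈ (Ioc 0 N).filter (fun q => IsPrimePow q), Real.log q ≤ C * N := by
  have hl4 : 0 < Real.log 4 := Real.log_pos (by norm_num)
  have hl2 : 0 < Real.log 2 := Real.log_pos (by norm_num)
  refine ⟨Real.log 4 + Real.log 4 * (16 / Real.log 2 ^ 2), by positivity, fun N => ?_⟩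
  rcases Nat.eq_zero_or_pos N with rfl | hN
  · simp
  have hN1 : (1 : ℝ) ≤ N := by exact_mod_cast hN
  set y := (N : ℝ) with hy
  have hy0 : 0 ≤ y := by linarith
  set L := ⌊Real.log y / Real.log 2⌋₊ with hL
  have hlog0 : 0 ≤ Real.log y := Real.log_nonneg hN1
  have hLle : (L : ℝ) ≤ Real.log y / Real.log 2 := Nat.floor_le (by positivity)
  have hlog : Real.log y ≤ 4 * y ^ (1 / 4 : ℝ) := by
    have := Real.log_le_rpow_div hy0 (show (0 : ℝ) < 1 / 4 by norm_num)
    linarith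
  have hsq : Real.log y ^ 2 ≤ 16 * y ^ (1 / 2 : ℝ) := by
    calc Real.log y ^ 2 ≤ (4 * y ^ (1 / 4 : ℝ)) ^ 2 := by gcongr
      _ = 16 * y ^ (1 / 2 : ℝ) := by
        rw [mul_pow, ← Real.rpow_natCast (y ^ (1 / 4 : ℝ)), ← Real.rpow_mul hy0]; norm_num
  have hmain : ∑ q ∈ (Ioc 0 N).filter (fun q => IsPrimePow q), Real.log q =
      ∑ k ∈ Icc 1 L, k * Chebyshev.theta (y ^ ((1 : ℝ) / k)) := by
    have := Chebyshev.sum_PrimePow_eq_sum_sum (fun q : ℕ => Real.log q) hy0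
    rw [hy, Nat.floor_natCast] at this
    convert this using 2 with k hk
    rw [Chebyshev.theta, mul_sum]
    refine sum_congr (by congr) fun p _ => ?_
    push_cast
    rw [Real.log_pow]
  have hterm : ∀ k ∈ Icc 1 L, (k : ℝ) * Chebyshev.theta (y ^ ((1 : ℝ) / k)) ≤
      (if k = 1 then Real.log 4 * y else 0) + L * (Real.log 4 * y ^ (1 / 2 : ℝ)) := by
    intro k hk
    obtain ⟨hk1, hkL⟩ := mem_Icc.1 hk
    have hth := Chebyshev.theta_le_log4_mul_x (x := y ^ ((1 : ℝ) / k)) (by positivity)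
    split_ifs with h1
    · subst h1
      norm_num at hth ⊢
      have : 0 ≤ L * (Real.log 4 * y ^ (1 / 2 : ℝ)) := by positivity
      norm_num at this
      linarith
    · rw [zero_add]
      have hk2 : (2 : ℝ) ≤ k := by exact_mod_cast (by omega : 2 ≤ k)
      have : y ^ ((1 : ℝ) / k) ≤ y ^ (1 / 2 : ℝ) := by gcongr
      gcongr
      exact hth.trans (by gcongr)
  rw [hmain]
  calc _ ≤ ∑ k ∈ Icc 1 L, ((if k = 1 then Real.log 4 * y else 0) +
        L * (Real.log 4 * y ^ (1 / 2 : ℝ))) := sum_le_sum hterm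
    _ ≤ Real.log 4 * y + L * (L * (Real.log 4 * y ^ (1 / 2 : ℝ))) := by
      rw [sum_add_distrib, sum_const, Nat.card_Icc, nsmul_eq_mul, Nat.add_sub_cancel,
        sum_ite_eq']
      gcongr
      split_ifs
      · exact le_rfl
      · positivity
    _ ≤ Real.log 4 * y +
        (Real.log y / Real.log 2) * ((Real.log y / Real.log 2) *
          (Real.log 4 * y ^ (1 / 2 : ℝ))) := by gcongr
    _ = Real.log 4 * y + Real.log 4 * (Real.log y ^ 2 / Real.log 2 ^ 2) * y ^ (1 / 2 : ℝ) := by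
      field_simp
    _ ≤ Real.log 4 * y + Real.log 4 * (16 * y ^ (1 / 2 : ℝ) / Real.log 2 ^ 2) *
        y ^ (1 / 2 : ℝ) := by gcongr
    _ = Real.log 4 * y + Real.log 4 * (16 / Real.log 2 ^ 2) *
        (y ^ (1 / 2 : ℝ) * y ^ (1 / 2 : ℝ)) := by ring
    _ = _ := by
      rw [← Real.rpow_add (by linarith)]
      norm_num
      ring

theorem sum_inv_primePowersIn_le : ∃ C : ℝ, 0 ≤ C ∧ ∀ (E : Set ℕ) (N : ℕ),
    ∑ q ∈ primePowersIn E N, (1 : ℝ) / q ≤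
      (∑ p ∈ (Iic N).filter (fun p => p.Prime ∧ p ∈ E), (1 : ℝ) / p) + C := by
  have hs : Summable (fun n : ℕ => (1 : ℝ) / n ^ 2) :=
    Real.summable_one_div_nat_pow.2 one_lt_two
  set S := ∑' n : ℕ, (1 : ℝ) / n ^ 2 with hS
  have hS0 : 0 ≤ S := tsum_nonneg fun _ => by positivity
  refine ⟨4 * S * 2, by positivity, fun E N => ?_⟩
  set L := ⌊Real.log (N : ℝ) / Real.log 2⌋₊
  let f : ℕ → ℝ := fun q => if q.minFac ∈ E then 1 / (q : ℝ) else 0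
  set T := ∑ p ∈ (Iic N).filter (fun p => p.Prime ∧ p ∈ E), (1 : ℝ) / p with hT
  have hT0 : 0 ≤ T := sum_nonneg fun _ _ => by positivity
  have hmain : ∑ q ∈ primePowersIn E N, (1 : ℝ) / q =
      ∑ k ∈ Icc 1 L, ∑ p ∈ (Ioc 0 ⌊(N : ℝ) ^ ((1 : ℝ) / k)⌋₊).filter Nat.Prime, f (p ^ k) := by
    have := Chebyshev.sum_PrimePow_eq_sum_sum f (Nat.cast_nonneg N)
    rw [Nat.floor_natCast] at this
    rw [primePowersIn, ← filter_filter, sum_filter]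
    convert this using 2
  have hterm : ∀ k ∈ Icc 1 L,
      ∑ p ∈ (Ioc 0 ⌊(N : ℝ) ^ ((1 : ℝ) / k)⌋₊).filter Nat.Prime, f (p ^ k) ≤
      (if k = 1 then T else 0) + 4 * S * (1 / 2) ^ k := by
    intro k hk
    obtain ⟨hk1, -⟩ := mem_Icc.1 hk
    split_ifs with h1
    · subst h1
      have : ∑ p ∈ (Ioc 0 ⌊(N : ℝ) ^ ((1 : ℝ) / (1 : ℕ))⌋₊).filter Nat.Prime, f (p ^ 1) ≤ T := by
        simp only [Nat.cast_one, div_one, Real.rpow_one, Nat.floor_natCast, pow_one]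
        have hsub : ∑ p ∈ (Ioc 0 N).filter Nat.Prime, f p =
            ∑ p ∈ (Ioc 0 N).filter (fun p => p.Prime ∧ p ∈ E), (1 : ℝ) / p := by
          rw [← filter_filter, sum_filter (p := fun p => p ∈ E)]
          refine sum_congr rfl fun p hp => ?_
          simp only [f, (mem_filter.1 hp).2.minFac_eq]
        rw [hsub]
        refine sum_le_sum_of_subset_of_nonneg (filter_subset_filter _ fun p hp => ?_)
          fun _ _ _ => by positivity
        exact mem_Iic.2 (mem_Ioc.1 hp).2
      have : 0 ≤ 4 * S * (1 / 2) ^ 1 := by positivity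
      linarith
    · rw [zero_add]
      obtain ⟨j, rfl⟩ : ∃ j, k = j + 2 := ⟨k - 2, by omega⟩
      calc _ ≤ ∑ p ∈ (Ioc 0 ⌊(N : ℝ) ^ ((1 : ℝ) / (j + 2 : ℕ))⌋₊).filter Nat.Prime,
            (1 / 2 : ℝ) ^ j * (1 / (p : ℝ) ^ 2) := by
            refine sum_le_sum fun p hp => ?_
            have hp2 : (2 : ℝ) ≤ p := by exact_mod_cast (mem_filter.1 hp).2.two_le
            have : f (p ^ (j + 2)) ≤ 1 / (p : ℝ) ^ (j + 2) := by
              simp only [f]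
              split_ifs
              · push_cast; exact le_rfl
              · positivity
            refine this.trans ?_
            rw [pow_add, one_div_pow, one_div_mul_one_div]
            gcongr
        _ = (1 / 2 : ℝ) ^ j * ∑ p ∈ (Ioc 0 ⌊(N : ℝ) ^ ((1 : ℝ) / (j + 2 : ℕ))⌋₊).filter Nat.Prime,
            (1 / (p : ℝ) ^ 2) := by rw [mul_sum]
        _ ≤ (1 / 2 : ℝ) ^ j * S := by
            gcongr
            exact hs.sum_le_tsum _ fun _ _ => by positivity
        _ = _ := by rw [pow_add]; ring
  rw [hmain]
  refine (sum_le_sum hterm).trans ?_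
  rw [sum_add_distrib, sum_ite_eq', ← mul_sum]
  have hgeo : ∑ k ∈ Icc 1 L, (1 / 2 : ℝ) ^ k ≤ 2 :=
    (summable_geometric_two.sum_le_tsum _ fun _ _ => by positivity).trans_eq tsum_geometric_two
  gcongr
  split_ifs
  · exact le_rfl
  · exact hT0

theorem sum_log_omegaLevel_succ_le : ∃ C : ℝ, 0 ≤ C ∧ ∀ (E : Set ℕ) (k N : ℕ),
    ∑ n ∈ omegaLevel E (k + 1) N, Real.log n ≤
      C * N * ∑ m ∈ omegaLevel E k N, (1 : ℝ) / m := by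
  obtain ⟨C, hC, h⟩ := sum_log_primePow_le
  refine ⟨C, hC, fun E k N => ?_⟩
  have hlog : ∀ n ∈ omegaLevel E (k + 1) N, Real.log n =
      ∑ p ∈ n.primeFactors, Real.log (ordProj[p] n : ℕ) := by
    intro n hn
    obtain ⟨⟨h1, -⟩, -⟩ := mem_omegaLevel.1 hn
    conv_lhs => rw [← Nat.prod_factorization_pow_eq_self (show n ≠ 0 by omega),
      Nat.prod_factorization_eq_prod_primeFactors]
    rw [Nat.cast_prod, Real.log_prod]
    intro p hp
    exact_mod_cast (pow_pos (Nat.prime_of_mem_primeFactors hp).pos _).ne'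
  rw [sum_congr rfl hlog, mul_sum]
  refine (sum_omegaLevel_succ_le E k N (fun q _ => Real.log q)
    fun q _ => Real.log_natCast_nonneg q).trans (sum_le_sum fun m _ => ?_)
  calc _ ≤ ∑ q ∈ (Ioc 0 (N / m)).filter (fun q => IsPrimePow q), Real.log q := by
        refine sum_le_sum_of_subset_of_nonneg (fun q hq => ?_)
          fun q _ _ => Real.log_natCast_nonneg q
        obtain ⟨⟨h1, h2⟩, h3, -⟩ := mem_primePowersIn.1 hq
        exact mem_filter.2 ⟨mem_Ioc.2 ⟨h1, h2⟩, h3⟩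
    _ ≤ C * (N / m : ℕ) := h _
    _ ≤ C * (N / m) := by gcongr; exact Nat.cast_div_le
    _ = _ := by ring

theorem sum_inv_primes_le_one_add_log (E : Set ℕ) {x : ℝ} (hx : 1 ≤ x) :
    ∑ p ∈ (Iic ⌊x⌋₊).filter (fun p => p.Prime ∧ p ∈ E), (1 : ℝ) / p ≤ 1 + Real.log x := by
  refine le_trans ?_ (harmonic_floor_le_one_add_log x hx)
  rw [harmonic_eq_sum_Icc]
  push_cast
  simp only [one_div]
  refine sum_le_sum_of_subset_of_nonneg (fun p hp => ?_) fun _ _ _ => by positivity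
  obtain ⟨h1, h2, -⟩ := mem_filter.1 hp
  exact mem_Icc.2 ⟨h2.one_le, mem_Iic.1 h1⟩

theorem sqrt_mul_log_add_le {x c : ℝ} (hx : 1 < x) (hc : 0 ≤ c) :
    √x * (Real.log x + c) ≤ (16 + 4 * c) * x / Real.log x := by
  have hx0 : 0 ≤ x := by linarith
  have hl : 0 < Real.log x := Real.log_pos hx
  have hlog : Real.log x ≤ 4 * x ^ (1 / 4 : ℝ) := by
    have := Real.log_le_rpow_div hx0 (show (0 : ℝ) < 1 / 4 by norm_num)
    linarith
  have hq : (x ^ (1 / 4 : ℝ)) ^ 2 = √x := by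
    rw [← Real.rpow_natCast (x ^ (1 / 4 : ℝ)), ← Real.rpow_mul hx0, Real.sqrt_eq_rpow]; norm_num
  have hq1 : 1 ≤ x ^ (1 / 4 : ℝ) := Real.one_le_rpow hx.le (by norm_num)
  set t := x ^ (1 / 4 : ℝ)
  rw [le_div_iff₀ hl]
  calc √x * (Real.log x + c) * Real.log x ≤ √x * (4 * t + c * t) * (4 * t) := by
        gcongr
        nlinarith
    _ = (16 + 4 * c) * (√x * t ^ 2) := by ring
    _ = _ := by rw [hq, Real.mul_self_sqrt hx0]

/-- Corollary 2: for any set of primes `ℰ`, the number of `n ≤ x` all of whose prime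
factors lie in `ℰ` and with `ω(n) = k` is `≪ x (E(x)+O(1))^(k-1) / ((k-1)! log x)`. -/
theorem sifted_sets_HardyRamanujan :
    ∃ C₁ C₂ : ℝ, ∀ (E : Set ℕ) (x : ℝ) (k : ℕ),
      (∀ p ∈ E, p.Prime) → 2 ≤ x → 1 ≤ k →
      (((Finset.Icc 1 ⌊x⌋₊).filter
          (fun n => (∀ p ∈ n.primeFactors, p ∈ E) ∧ n.primeFactors.card = k)).card : ℝ)
        ≤ C₁ * x *
            ((∑ p ∈ (Finset.Iic ⌊x⌋₊).filter (fun p => p.Prime ∧ p ∈ E), (1 : ℝ) / p) + C₂) ^ (k - 1) /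
            ((Nat.factorial (k - 1) : ℝ) * Real.log x) := by
  obtain ⟨C, hC, hlogsum⟩ := sum_log_omegaLevel_succ_le
  obtain ⟨K, hK, hinv⟩ := sum_inv_primePowersIn_le
  refine ⟨2 * C + (16 + 4 * (1 + K)), K, fun E x k _ hx hk => ?_⟩
  obtain ⟨j, rfl⟩ : ∃ j, k = j + 1 := ⟨k - 1, by omega⟩
  rw [Nat.add_sub_cancel]
  change ((omegaLevel E (j + 1) ⌊x⌋₊).card : ℝ) ≤ _
  have hE := sum_inv_primes_le_one_add_log E (show 1 ≤ x by linarith)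
  have hE0 : 0 ≤ ∑ p ∈ (Iic ⌊x⌋₊).filter (fun p => p.Prime ∧ p ∈ E), (1 : ℝ) / p :=
    sum_nonneg fun _ _ => by positivity
  have hR := hinv E ⌊x⌋₊
  have hR0 : 0 ≤ ∑ q ∈ primePowersIn E ⌊x⌋₊, (1 : ℝ) / q := sum_nonneg fun _ _ => by positivity
  set B := (∑ p ∈ (Iic ⌊x⌋₊).filter (fun p => p.Prime ∧ p ∈ E), (1 : ℝ) / p) + K with hB
  have hB0 : 0 ≤ B := by positivity
  have hx0 : 0 ≤ x := by linarith
  have hl : 0 < Real.log x := Real.log_pos (by linarith)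
  have hrec : ∀ i, ∑ m ∈ omegaLevel E i ⌊x⌋₊, (1 : ℝ) / m ≤ B ^ i / (i.factorial : ℝ) :=
    fun i => (sum_inv_omegaLevel_le E _ i).trans (by gcongr)
  set M := B ^ j / (j.factorial : ℝ) with hM
  have hM0 : 0 ≤ M := by positivity
  have hrec' : ∑ m ∈ omegaLevel E (j + 1) ⌊x⌋₊, (1 : ℝ) / m ≤ M * B := by
    refine (hrec (j + 1)).trans ?_
    rw [hM, pow_succ, div_mul_eq_mul_div]
    gcongr
    omega
  have hpoint : ∀ n ∈ omegaLevel E (j + 1) ⌊x⌋₊,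
      (1 : ℝ) ≤ 2 / Real.log x * Real.log n + √x * (1 / n) := by
    intro n hn
    obtain ⟨⟨h1, -⟩, -⟩ := mem_omegaLevel.1 hn
    have hn1 : (1 : ℝ) ≤ n := by exact_mod_cast h1
    have ha : 0 ≤ 2 / Real.log x * Real.log n :=
      mul_nonneg (by positivity) (Real.log_nonneg hn1)
    have hb : 0 ≤ √x * (1 / n) := by positivity
    rcases le_total (n : ℝ) (√x) with h | h
    · have : 1 ≤ √x * (1 / n) := by
        rw [mul_one_div, le_div_iff₀ (by linarith)]; linarith
      linarith
    · have hlog := Real.log_le_log (Real.sqrt_pos.2 (by linarith)) h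
      rw [Real.log_sqrt hx0] at hlog
      have : 1 ≤ 2 / Real.log x * Real.log n := by
        rw [div_mul_eq_mul_div, le_div_iff₀ hl]; linarith
      linarith
  calc ((omegaLevel E (j + 1) ⌊x⌋₊).card : ℝ)
      = ∑ n ∈ omegaLevel E (j + 1) ⌊x⌋₊, (1 : ℝ) := by simp
    _ ≤ ∑ n ∈ omegaLevel E (j + 1) ⌊x⌋₊, (2 / Real.log x * Real.log n + √x * (1 / n)) :=
        sum_le_sum hpoint
    _ = 2 / Real.log x * ∑ n ∈ omegaLevel E (j + 1) ⌊x⌋₊, Real.log n +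
        √x * ∑ n ∈ omegaLevel E (j + 1) ⌊x⌋₊, (1 : ℝ) / n := by
        rw [sum_add_distrib, mul_sum, mul_sum]
    _ ≤ 2 / Real.log x * (C * x * M) + √x * (M * (Real.log x + (1 + K))) := by
        gcongr
        · refine (hlogsum E j ⌊x⌋₊).trans ?_
          gcongr
          · exact Nat.floor_le hx0
          · exact hrec j
        · refine hrec'.trans ?_
          gcongr
          linarith
    _ = 2 / Real.log x * (C * x * M) + M * (√x * (Real.log x + (1 + K))) := by ring
    _ ≤ 2 / Real.log x * (C * x * M) + M * ((16 + 4 * (1 + K)) * x / Real.log x) := by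
        gcongr
        exact sqrt_mul_log_add_le (by linarith) (by linarith)
    _ = _ := by
        rw [hM]
        field_simp
end
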